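/- arXiv:1610.09541 — 4 statements merged into one kernel-verified Lean document; each statement's English description precedes it below -/
import Mathlib

section
/- For integers a₁,…,aₘ, the quadratic form Σᵢ aᵢXᵢ² is universal over M₂(ℤ) (i.e., every 2×2 integer matrix is of the form Σᵢ aᵢAᵢ² with Aᵢ ∈ M₂(ℤ)) if and only if no prime divides m−1 of the numbers a₁,…,aₘ, and at least three of a₁,…,aₘ are not multiples of 4. -/
lemma aux_ideal (J : Ideal ℤ) (h : ∀ p : ℕ, p.Prime → ∃ n ∈ J, ¬ (p : ℤ) ∣ n) : (1 : ℤ) ∈ J := by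
  obtain ⟨n, hn⟩ := IsPrincipalIdealRing.principal J
  have hn' : J = Ideal.span {n} := hn
  by_cases h1 : n.natAbs = 1
  · rw [hn', Ideal.mem_span_singleton]
    exact Int.isUnit_iff_natAbs_eq.2 h1 |>.dvd
  · obtain ⟨p, hp, hd⟩ := Nat.exists_prime_and_dvd h1
    obtain ⟨k, hk, hk'⟩ := h p hp
    rw [hn', Ideal.mem_span_singleton] at hk
    exact absurd ((Int.natCast_dvd.2 hd).trans hk) hk'

lemma aux_prim {ι : Type*} [Fintype ι] [DecidableEq ι] (r : ι → ℤ)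
    (h : ∀ p : ℕ, p.Prime → ∃ i, ¬ (p : ℤ) ∣ r i) : ∃ w : ι → ℤ, ∑ i, r i * w i = 1 := by
  have := aux_ideal
    { carrier := {n | ∃ w : ι → ℤ, ∑ i, r i * w i = n}
      add_mem' := by
        rintro _ _ ⟨w, rfl⟩ ⟨v, rfl⟩
        exact ⟨w + v, by simp [mul_add, Finset.sum_add_distrib]⟩
      zero_mem' := ⟨0, by simp⟩
      smul_mem' := by
        rintro c _ ⟨w, rfl⟩
        exact ⟨c • w, by simp [Finset.mul_sum, mul_left_comm]⟩ } ?_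
  · exact this
  · intro p hp
    obtain ⟨i, hi⟩ := h p hp
    exact ⟨r i, ⟨Pi.single i 1, by simp [Pi.single_apply]⟩, hi⟩

lemma aux_surj {ι : Type*} [Fintype ι] [DecidableEq ι] (r q : ι → ℤ)
    (H : ∀ p : ℕ, p.Prime → ∃ i j, ¬ (p : ℤ) ∣ r i * q j - r j * q i) (g h : ℤ) :
    ∃ z : ι → ℤ, ∑ i, r i * z i = g ∧ ∑ i, q i * z i = h := by
  have := aux_ideal
    { carrier := {n | ∃ z : ι → ℤ, ∑ i, r i * z i = n * g ∧ ∑ i, q i * z i = n * h}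
      add_mem' := by
        rintro m n ⟨w, hw, hw'⟩ ⟨v, hv, hv'⟩
        exact ⟨w + v, by simp [mul_add, Finset.sum_add_distrib, *, add_mul],
          by simp [mul_add, Finset.sum_add_distrib, *, add_mul]⟩
      zero_mem' := ⟨0, by simp⟩
      smul_mem' := by
        rintro c n ⟨w, hw, hw'⟩
        refine ⟨c • w, ?_, ?_⟩
        · simp [mul_left_comm, ← Finset.mul_sum, hw, mul_assoc]
        · simp [mul_left_comm, ← Finset.mul_sum, hw', mul_assoc] } ?_
  · obtain ⟨z, h1, h2⟩ := this
    exact ⟨z, by simpa using h1, by simpa using h2⟩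
  · intro p hp
    obtain ⟨i, j, hi⟩ := H p hp
    refine ⟨_, ⟨Pi.single i (g * q j - h * r j) + Pi.single j (h * r i - g * q i), ?_, ?_⟩, hi⟩
    · simp [Pi.single_apply, mul_add, Finset.sum_add_distrib]; ring
    · simp [Pi.single_apply, mul_add, Finset.sum_add_distrib]; ring

lemma aux_crt (P : Finset ℕ) (hP : ∀ p ∈ P, p.Prime) (f : ℕ → ℤ) :
    ∃ n : ℤ, ∀ p ∈ P, (p : ℤ) ∣ n - f p := by
  induction P using Finset.induction_on with
  | empty => exact ⟨0, by simp⟩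
  | insert p P hp ih =>
    obtain ⟨n, hn⟩ := ih fun q hq => hP q (Finset.mem_insert_of_mem hq)
    have hc : IsCoprime (p : ℤ) ((∏ q ∈ P, q : ℕ) : ℤ) := by
      rw [Nat.isCoprime_iff_coprime]
      apply Nat.Coprime.prod_right
      intro q hq
      rw [Nat.coprime_primes (hP p (by simp)) (hP q (by simp [hq]))]
      rintro rfl; exact hp hq
    obtain ⟨u, v, huv⟩ := hc
    refine ⟨n + v * ((∏ q ∈ P, q : ℕ) : ℤ) * (f p - n), ?_⟩
    intro q hq
    rcases Finset.mem_insert.1 hq with rfl | hq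
    · refine ⟨u * (n - f q), ?_⟩
      linear_combination (f q - n) * huv
    · have h1 : (q : ℤ) ∣ ((∏ q ∈ P, q : ℕ) : ℤ) := by
        exact_mod_cast Finset.dvd_prod_of_mem (fun q => q) hq
      have h2 := hn q hq
      have : n + v * ((∏ q ∈ P, q : ℕ) : ℤ) * (f p - n) - f q
        = (n - f q) + ((∏ q ∈ P, q : ℕ) : ℤ) * (v * (f p - n)) := by ring
      rw [this]
      exact dvd_add h2 (h1.mul_right _)

lemma aux_core {ι : Type*} [Fintype ι] [DecidableEq ι] (a t : ι → ℤ) (i0 : ι) (ht0 : t i0 = 0)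
    (ha0 : a i0 ≠ 0) (β : ℤ) (h1 : ∀ p : ℕ, p.Prime → ∃ i, ¬ (p : ℤ) ∣ a i * t i)
    (h2 : ∀ p : ℕ, p.Prime → (p : ℤ) ∣ a i0 → ∃ y : ι → ℤ, (p : ℤ) ∣ ∑ i, a i * t i * y i - β ∧
      ∃ i j, ¬ (p : ℤ) ∣ a i * a j * (t i * y j - t j * y i)) :
    ∃ y : ι → ℤ, y i0 = 1 ∧ ∑ i, a i * t i * y i = β ∧
      ∀ g h : ℤ, ∃ z : ι → ℤ, ∑ i, a i * t i * z i = g ∧ ∑ i, a i * y i * z i = h := by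
  obtain ⟨w, hw⟩ := aux_prim (fun i => a i * t i) h1
  have hY : ∀ p : ℕ, ∃ y : ι → ℤ, p.Prime → (p : ℤ) ∣ a i0 → 
      ((p : ℤ) ∣ ∑ i, a i * t i * y i - β ∧
      ∃ i j, ¬ (p : ℤ) ∣ a i * a j * (t i * y j - t j * y i)) := by
    intro p
    by_cases hp : p.Prime ∧ (p : ℤ) ∣ a i0
    · obtain ⟨y, hy⟩ := h2 p hp.1 hp.2
      exact ⟨y, fun _ _ => hy⟩
    · exact ⟨0, fun h h' => absurd ⟨h, h'⟩ hp⟩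
  choose Y hY using hY
  have hc := fun i => aux_crt (a i0).natAbs.primeFactors (fun p hp => Nat.prime_of_mem_primeFactors hp)
    (fun p => Y p i)
  choose y' hy' using hc
  set E := ∑ i, a i * t i * y' i - β with hE
  let y : ι → ℤ := Function.update (fun i => y' i - E * w i) i0 1
  have hy0 : y i0 = 1 := by simp [y]
  have hyi : ∀ i, i ≠ i0 → y i = y' i - E * w i := fun i hi => by simp [y, hi]
  have hmem : ∀ p : ℕ, p.Prime → (p : ℤ) ∣ a i0 → p ∈ (a i0).natAbs.primeFactors := by
    intro p hp hd
    simp [hp, ha0, Int.natCast_dvd.1 hd]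
  refine ⟨y, hy0, ?_, ?_⟩
  · have : ∑ i, a i * t i * y i = ∑ i, (a i * t i * y' i - E * (a i * t i * w i)) := by
      apply Finset.sum_congr rfl
      intro i _
      by_cases hi : i = i0
      · subst hi; simp [ht0]
      · rw [hyi i hi]; ring
    rw [this, Finset.sum_sub_distrib, ← Finset.mul_sum, hw]
    simp [hE]
  · apply aux_surj
    intro p hp
    by_cases hd : (p : ℤ) ∣ a i0
    · have hm := hmem p hp hd
      obtain ⟨hs, i, j, hij⟩ := hY p hp hd
      have hpE : (p : ℤ) ∣ E := by
        have : E = ∑ i, a i * t i * (y' i - Y p i) + (∑ i, a i * t i * Y p i - β) := by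
          simp only [mul_sub, Finset.sum_sub_distrib, hE]; ring
        rw [this]
        exact dvd_add (Finset.dvd_sum fun i _ => (hy' i p hm).mul_left _) hs
      have hi : i ≠ i0 := by
        rintro rfl
        exact hij ((hd.mul_right _).mul_right _)
      have hj : j ≠ i0 := by
        rintro rfl
        exact hij ((hd.mul_left _).mul_right _)
      have hcong : ∀ k, k ≠ i0 → (p : ℤ) ∣ y k - Y p k := by
        intro k hk
        rw [hyi k hk, sub_right_comm]
        exact dvd_sub (hy' k p hm) (hpE.mul_right _)
      refine ⟨i, j, fun hh => hij ?_⟩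
      obtain ⟨c, hc⟩ := hcong i hi
      obtain ⟨d, hd⟩ := hcong j hj
      obtain ⟨e, he⟩ := hh
      refine ⟨e - a i * a j * (t i * d - t j * c), ?_⟩
      linear_combination he - a i * a j * t i * hd + a i * a j * t j * hc
    · obtain ⟨i, hi⟩ := h1 p hp
      refine ⟨i, i0, ?_⟩
      rw [ht0, hy0]
      have hpp := Nat.prime_iff_prime_int.1 hp
      simp only [mul_one, mul_zero, zero_mul, sub_zero]
      intro h
      rcases hpp.dvd_or_dvd h with h | h
      · exact hi h
      · exact hd h

lemma aux_t {m : ℕ} (a : Fin m → ℤ) (i0 : Fin m)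
    (ha : ∀ p : ℕ, p.Prime → ∀ i, ∃ j, j ≠ i ∧ ¬ (p : ℤ) ∣ a j)
    (P : Finset ℕ) (hP : ∀ p ∈ P, p.Prime ∧ (p : ℤ) ∣ a i0) :
    ∃ t : Fin m → ℤ, t i0 = 0 ∧
      (∀ p : ℕ, p.Prime → p ∉ P → ∀ i, i ≠ i0 → ¬ (p : ℤ) ∣ t i) ∧
      (∀ p ∈ P, ∃ i j, i ≠ j ∧ ¬ (p : ℤ) ∣ a i ∧ ¬ (p : ℤ) ∣ a j ∧ ¬ (p : ℤ) ∣ t i ∧ (p : ℤ) ∣ t j) := by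
  classical
  let T : Fin m → ℕ := fun k => ∏ p ∈ P.filter (fun p : ℕ => ∃ j < k, ¬ (p : ℤ) ∣ a j), p
  have hT : ∀ p : ℕ, p.Prime → ∀ k, p ∣ T k ↔ p ∈ P ∧ ∃ j < k, ¬ (p : ℤ) ∣ a j := by
    intro p hp k
    constructor
    · intro h
      obtain ⟨q, hq, hd⟩ := (hp.prime.dvd_finsetProd_iff _).1 h
      rw [Finset.mem_filter] at hq
      have := (Nat.prime_dvd_prime_iff_eq hp (hP q hq.1).1).1 hd
      subst this
      exact hq
    · intro h
      exact Finset.dvd_prod_of_mem (fun q : ℕ => q) (Finset.mem_filter.2 h)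
  let t : Fin m → ℤ := fun k => if k = i0 then 0 else (T k : ℤ)
  have ht : ∀ k, k ≠ i0 → t k = T k := fun k hk => by simp [t, hk]
  refine ⟨t, by simp [t], ?_, ?_⟩
  · intro p hp hpP i hi
    rw [ht i hi, Int.natCast_dvd_natCast, hT p hp]
    exact fun h => hpP h.1
  · intro p hpP
    obtain ⟨hp, hd⟩ := hP p hpP
    obtain ⟨i1, -, hi1⟩ := ha p hp i0
    obtain ⟨i, hi, hmin⟩ := exists_minimal_of_wellFoundedLT (fun i => ¬ (p : ℤ) ∣ a i) ⟨i1, hi1⟩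
    obtain ⟨j, hj, hja⟩ := ha p hp i
    have hii : i ≠ i0 := by rintro rfl; exact hi hd
    have hjj : j ≠ i0 := by rintro rfl; exact hja hd
    refine ⟨i, j, hj.symm, hi, hja, ?_, ?_⟩
    · rw [ht i hii, Int.natCast_dvd_natCast, hT p hp]
      rintro ⟨-, k, hk, hka⟩
      exact absurd (hmin hka hk.le) (not_le.2 hk)
    · rw [ht j hjj, Int.natCast_dvd_natCast, hT p hp]
      refine ⟨hpP, i, ?_, hi⟩
      rcases lt_or_gt_of_ne hj with h | h
      · exact absurd (hmin hja h.le) (not_le.2 h)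
      · exact h

/-- the local solution at a prime where t has a unit and a zero -/
lemma aux_local {ι : Type*} [Fintype ι] [DecidableEq ι] (a t : ι → ℤ) (β : ℤ) (p : ℕ) (hp : p.Prime)
    (h : ∃ i j, i ≠ j ∧ ¬ (p : ℤ) ∣ a i ∧ ¬ (p : ℤ) ∣ a j ∧ ¬ (p : ℤ) ∣ t i ∧ (p : ℤ) ∣ t j) :
    ∃ y : ι → ℤ, (p : ℤ) ∣ ∑ i, a i * t i * y i - β ∧
      ∃ i j, ¬ (p : ℤ) ∣ a i * a j * (t i * y j - t j * y i) := by
  obtain ⟨i, j, hij, hai, haj, hti, htj⟩ := h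
  have hpp := Nat.prime_iff_prime_int.1 hp
  have hc : IsCoprime (p : ℤ) (a i * t i) := by
    refine (hpp.irreducible.coprime_iff_not_dvd).2 fun h => ?_
    rcases hpp.dvd_or_dvd h with h | h
    · exact hai h
    · exact hti h
  obtain ⟨u, v, huv⟩ := hc
  obtain ⟨c, hc⟩ := htj
  refine ⟨Pi.single i (v * β) + Pi.single j 1, ?_, i, j, ?_⟩
  · simp only [Pi.add_apply, Pi.single_apply, mul_add, Finset.sum_add_distrib, mul_ite, mul_zero,
      Finset.sum_ite_eq', Finset.mem_univ, if_true]
    refine ⟨a j * c - u * β, ?_⟩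
    linear_combination β * huv + a j * hc
  · simp only [Pi.add_apply, Pi.single_apply, hij, hij.symm, if_true, if_false, add_zero, zero_add]
    rw [hc]
    intro h
    have h3 : (p : ℤ) ∣ a i * a j * t i := by
      obtain ⟨e, he⟩ := h
      refine ⟨e + a i * a j * c * (v * β), ?_⟩
      linear_combination he
    rcases hpp.dvd_or_dvd h3 with h | h
    · rcases hpp.dvd_or_dvd h with h | h
      · exact hai h
      · exact haj h
    · exact hti h

lemma aux_mat {ι : Type*} [Fintype ι] (a : ι → ℤ) (M : Matrix (Fin 2) (Fin 2) ℤ)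
    (x y z w : ι → ℤ) (h00 : M 0 0 = ∑ i, a i * (x i * x i + y i * z i))
    (h01 : M 0 1 = ∑ i, a i * (x i * y i + y i * w i))
    (h10 : M 1 0 = ∑ i, a i * (z i * x i + w i * z i))
    (h11 : M 1 1 = ∑ i, a i * (z i * y i + w i * w i)) :
    ∃ A : ι → Matrix (Fin 2) (Fin 2) ℤ, M = ∑ i, a i • (A i) ^ 2 := by
  refine ⟨fun i => !![x i, y i; z i, w i], ?_⟩
  ext k l
  fin_cases k <;> fin_cases l <;>
    simp [Matrix.sum_apply, pow_two, h00, h01, h10, h11]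

lemma aux_normal {ι : Type*} [Fintype ι] (a t y : ι → ℤ) (M : Matrix (Fin 2) (Fin 2) ℤ)
    (hy : ∑ i, a i * t i * y i = M 0 1)
    (hpar : (2 : ℤ) ∣ M 0 0 - M 1 1 - ∑ i, a i * t i)
    (hs : ∀ g h : ℤ, ∃ z : ι → ℤ, ∑ i, a i * t i * z i = g ∧ ∑ i, a i * y i * z i = h) :
    ∃ A : ι → Matrix (Fin 2) (Fin 2) ℤ, M = ∑ i, a i • (A i) ^ 2 := by
  have hpar2 : (2 : ℤ) ∣ M 0 0 - M 1 1 - ∑ i, a i * t i * t i := by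
    have h : (2 : ℤ) ∣ ∑ i, a i * (t i * t i - t i) := by
      apply Finset.dvd_sum
      intro i _
      apply Dvd.dvd.mul_left
      have := Int.even_mul_pred_self (t i)
      rw [mul_sub, mul_one] at this
      exact this.two_dvd
    have := dvd_sub hpar h
    have e : ∑ i, a i * (t i * t i - t i) = ∑ i, a i * t i * t i - ∑ i, a i * t i := by
      rw [← Finset.sum_sub_distrib]
      exact Finset.sum_congr rfl fun i _ => by ring
    omega
  obtain ⟨c, hc⟩ := hpar2
  obtain ⟨k, hk, -⟩ := hs c 0
  obtain ⟨z, hz, hz'⟩ := hs (M 1 0) (M 1 1 - ∑ i, a i * (k i * k i))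
  refine aux_mat a M (fun i => t i + k i) y z (fun i => - k i) ?_ ?_ ?_ ?_
  · have : ∑ i, a i * ((t i + k i) * (t i + k i) + y i * z i) =
      ∑ i, a i * t i * t i + 2 * ∑ i, a i * t i * k i + ∑ i, a i * (k i * k i)
        + ∑ i, a i * y i * z i := by
      simp only [Finset.mul_sum, ← Finset.sum_add_distrib]
      exact Finset.sum_congr rfl fun i _ => by ring
    rw [this, hk, hz']
    linear_combination hc
  · rw [← hy]
    exact Finset.sum_congr rfl fun i _ => by ring
  · rw [← hz]
    exact Finset.sum_congr rfl fun i _ => by ring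
  · have : ∑ i, a i * (z i * y i + - k i * - k i) =
      ∑ i, a i * (k i * k i) + ∑ i, a i * y i * z i := by
      simp only [← Finset.sum_add_distrib]
      exact Finset.sum_congr rfl fun i _ => by ring
    rw [this, hz']; ring

lemma aux_special1 {ι : Type*} [Fintype ι] (a t y : ι → ℤ) (M : Matrix (Fin 2) (Fin 2) ℤ)
    (hy : 2 * ∑ i, a i * t i * y i = M 0 1) (h10 : (2 : ℤ) ∣ M 1 0)
    (hpar : (4 : ℤ) ∣ M 0 0 - M 1 1)
    (hs : ∀ g h : ℤ, ∃ z : ι → ℤ, ∑ i, a i * t i * z i = g ∧ ∑ i, a i * y i * z i = h) :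
    ∃ A : ι → Matrix (Fin 2) (Fin 2) ℤ, M = ∑ i, a i • (A i) ^ 2 := by
  obtain ⟨c, hc⟩ := hpar
  obtain ⟨d, hd⟩ := h10
  obtain ⟨k, hk, -⟩ := hs c 0
  obtain ⟨z, hz, hz'⟩ := hs d (M 1 1 - ∑ i, a i * ((t i - k i) * (t i - k i)))
  have e1 : ∑ i, a i * (z i * y i + (t i - k i) * (t i - k i)) =
      ∑ i, a i * ((t i - k i) * (t i - k i)) + ∑ i, a i * y i * z i := by
    simp only [← Finset.sum_add_distrib]
    exact Finset.sum_congr rfl fun i _ => by ring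
  refine aux_mat a M (fun i => t i + k i) y z (fun i => t i - k i) ?_ ?_ ?_ ?_
  · have : ∑ i, a i * ((t i + k i) * (t i + k i) + y i * z i) =
      4 * ∑ i, a i * t i * k i + ∑ i, a i * (z i * y i + (t i - k i) * (t i - k i)) := by
      simp only [Finset.mul_sum, ← Finset.sum_add_distrib]
      exact Finset.sum_congr rfl fun i _ => by ring
    rw [this, e1, hk, hz']
    linear_combination hc
  · rw [← hy, Finset.mul_sum]
    exact Finset.sum_congr rfl fun i _ => by ring
  · rw [hd, ← hz, Finset.mul_sum]
    exact Finset.sum_congr rfl fun i _ => by ring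
  · rw [e1, hz']; ring

lemma aux_special2 {ι : Type*} [Fintype ι] [DecidableEq ι] (a y s : ι → ℤ) (i0 : ι)
    (M : Matrix (Fin 2) (Fin 2) ℤ) (hy0 : y i0 = 0) (hs0 : s i0 = 1)
    (hy : 2 * ∑ i, a i * y i * s i = M 0 1) (h10 : (2 : ℤ) ∣ M 1 0)
    (hpar : (4 : ℤ) ∣ M 0 0 - M 1 1 - a i0)
    (hs : ∀ g h : ℤ, ∃ z : ι → ℤ, ∑ i, a i * y i * z i = g ∧ ∑ i, a i * s i * z i = h) :
    ∃ A : ι → Matrix (Fin 2) (Fin 2) ℤ, M = ∑ i, a i • (A i) ^ 2 := by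
  obtain ⟨c, hc⟩ := hpar
  obtain ⟨d, hd⟩ := h10
  obtain ⟨k, -, hk⟩ := hs 0 c
  obtain ⟨z, hz', hz⟩ := hs (M 1 1 - ∑ i, a i * ((s i - k i) * (s i - k i))
    - a i0 * (3 * k i0 * k i0 + 2 * k i0 - 1)) d
  -- the entries, with a correction at `i0`
  let x : ι → ℤ := fun i => if i = i0 then 1 + 2 * k i else s i + k i
  let z1 : ι → ℤ := fun i => if i = i0 then 2 * z i else z i
  let w : ι → ℤ := fun i => if i = i0 then - 2 * k i else s i - k i
  have key : ∀ f : ι → ℤ, ∀ h : ℤ, ∑ i, (f i + if i = i0 then h else 0) = ∑ i, f i + h := by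
    intro f h
    simp [Finset.sum_add_distrib]
  have e1 : ∑ i, a i * (z1 i * y i + w i * w i) =
      ∑ i, a i * ((s i - k i) * (s i - k i)) + ∑ i, a i * y i * z i
        + a i0 * (3 * k i0 * k i0 + 2 * k i0 - 1) := by
    rw [← Finset.sum_add_distrib, ← key]
    refine Finset.sum_congr rfl fun i _ => ?_
    by_cases hi : i = i0
    · subst hi; simp [z1, w, hy0, hs0]; ring
    · simp [z1, w, hi]; ring
  refine aux_mat a M x y z1 w ?_ ?_ ?_ ?_
  · have : ∑ i, a i * (x i * x i + y i * z1 i) =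
      4 * ∑ i, a i * s i * k i + ∑ i, a i * (z1 i * y i + w i * w i) + a i0 := by
      rw [Finset.mul_sum, ← Finset.sum_add_distrib, ← key]
      refine Finset.sum_congr rfl fun i _ => ?_
      by_cases hi : i = i0
      · subst hi; simp [x, z1, w, hy0, hs0]; ring
      · simp [x, z1, w, hi]; ring
    rw [this, e1, hk, hz']
    linear_combination hc
  · rw [← hy, Finset.mul_sum]
    refine Finset.sum_congr rfl fun i _ => ?_
    by_cases hi : i = i0
    · subst hi; simp [hy0]
    · simp [x, w, hi]; ring
  · rw [hd, ← hz, Finset.mul_sum]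
    refine Finset.sum_congr rfl fun i _ => ?_
    by_cases hi : i = i0
    · subst hi; simp [x, z1, w, hs0]; ring
    · simp [x, z1, w, hi]; ring
  · rw [e1, hz']; ring

/-- sum modulo 2 when exactly two coefficients are odd -/
lemma aux_sum2 {ι : Type*} [Fintype ι] [DecidableEq ι] (a t : ι → ℤ) (i j : ι) (hij : i ≠ j)
    (hi : ¬ (2 : ℤ) ∣ a i) (hj : ¬ (2 : ℤ) ∣ a j) (h : ∀ k, k ≠ i → k ≠ j → (2 : ℤ) ∣ a k) :
    (2 : ℤ) ∣ ∑ k, a k * t k - (t i + t j) := by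
  have : ∑ k, a k * t k - (t i + t j) = ∑ k, (a k * t k - ((if k = i then t i else 0)
      + if k = j then t j else 0)) := by
    simp [Finset.sum_sub_distrib, Finset.sum_add_distrib]
  rw [this]
  refine Finset.dvd_sum fun k _ => ?_
  by_cases h1 : k = i
  · subst h1
    simp only [if_true, hij, if_false, add_zero]
    obtain ⟨c, hc⟩ : (2 : ℤ) ∣ a k - 1 := by omega
    exact ⟨c * t k, by linear_combination t k * hc⟩
  · by_cases h2 : k = j
    · subst h2
      simp only [if_true, h1, if_false, zero_add]
      obtain ⟨c, hc⟩ : (2 : ℤ) ∣ a k - 1 := by omega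
      exact ⟨c * t k, by linear_combination t k * hc⟩
    · simp only [h1, h2, if_false, add_zero, sub_zero]
      exact (h k h1 h2).mul_right _

lemma aux_default {m : ℕ} (a : Fin m → ℤ) (i0 : Fin m) (ha0 : a i0 ≠ 0)
    (ha : ∀ p : ℕ, p.Prime → ∀ i, ∃ j, j ≠ i ∧ ¬ (p : ℤ) ∣ a j) :
    ∃ t : Fin m → ℤ, t i0 = 0 ∧
      (∀ p : ℕ, p.Prime → ¬ (p : ℤ) ∣ a i0 → ∀ i, i ≠ i0 → ¬ (p : ℤ) ∣ t i) ∧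
      (∀ p : ℕ, p.Prime → (p : ℤ) ∣ a i0 → ∃ i j, i ≠ j ∧ ¬ (p : ℤ) ∣ a i ∧ ¬ (p : ℤ) ∣ a j ∧
        ¬ (p : ℤ) ∣ t i ∧ (p : ℤ) ∣ t j) ∧
      ∀ β : ℤ, ∃ y : Fin m → ℤ, y i0 = 1 ∧ ∑ i, a i * t i * y i = β ∧
      ∀ g h : ℤ, ∃ z : Fin m → ℤ, ∑ i, a i * t i * z i = g ∧ ∑ i, a i * y i * z i = h := by
  have hmem : ∀ p : ℕ, p ∈ (a i0).natAbs.primeFactors ↔ p.Prime ∧ (p : ℤ) ∣ a i0 := by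
    intro p
    simp [ha0, Int.natCast_dvd]
  obtain ⟨t, h0, h1, h2⟩ := aux_t a i0 ha (a i0).natAbs.primeFactors (fun p hp => (hmem p).1 hp)
  refine ⟨t, h0, fun p hp hd => h1 p hp (fun h => hd ((hmem p).1 h).2),
    fun p hp hd => h2 p ((hmem p).2 ⟨hp, hd⟩), fun β => ?_⟩
  apply aux_core a t i0 h0 ha0
  · intro p hp
    have hpp := Nat.prime_iff_prime_int.1 hp
    by_cases hd : (p : ℤ) ∣ a i0
    · obtain ⟨i, j, -, hi, -, hti, -⟩ := h2 p ((hmem p).2 ⟨hp, hd⟩)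
      exact ⟨i, fun h => (hpp.dvd_or_dvd h).elim hi hti⟩
    · obtain ⟨i, hi, hai⟩ := ha p hp i0
      exact ⟨i, fun h => (hpp.dvd_or_dvd h).elim hai (h1 p hp (fun h => hd ((hmem p).1 h).2) i hi)⟩
  · intro p hp hd
    exact aux_local a t β p hp (h2 p ((hmem p).2 ⟨hp, hd⟩))

/-- at least three odd coefficients -/
lemma aux_three {m : ℕ} (a : Fin m → ℤ) (i0 j l : Fin m) (h0j : j ≠ i0) (h0l : l ≠ i0) (hjl : j ≠ l)
    (hi0 : ¬ (2 : ℤ) ∣ a i0) (hj : ¬ (2 : ℤ) ∣ a j) (hl : ¬ (2 : ℤ) ∣ a l)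
    (ha : ∀ p : ℕ, p.Prime → ∀ i, ∃ j, j ≠ i ∧ ¬ (p : ℤ) ∣ a j)
    (M : Matrix (Fin 2) (Fin 2) ℤ) :
    ∃ A : Fin m → Matrix (Fin 2) (Fin 2) ℤ, M = ∑ i, a i • (A i) ^ 2 := by
  have ha0 : a i0 ≠ 0 := by rintro h; simp [h] at hi0
  obtain ⟨t, h0, h1, h2, h3⟩ := aux_default a i0 ha0 ha
  have htj : ¬ (2 : ℤ) ∣ t j := h1 2 Nat.prime_two hi0 j h0j
  have htl : ¬ (2 : ℤ) ∣ t l := h1 2 Nat.prime_two hi0 l h0l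
  by_cases hpar : (2 : ℤ) ∣ M 0 0 - M 1 1 - ∑ i, a i * t i
  · obtain ⟨y, -, hy, hs⟩ := h3 (M 0 1)
    exact aux_normal a t y M hy hpar hs
  · let t' : Fin m → ℤ := fun i => t i + if i = j then t j else 0
    have ht'j : t' j = 2 * t j := by simp [t']; ring
    have ht' : ∀ i, i ≠ j → t' i = t i := fun i hi => by simp [t', hi]
    have hdv : ∀ p : ℕ, p.Prime → p ≠ 2 → ∀ i, (p : ℤ) ∣ t' i ↔ (p : ℤ) ∣ t i := by
      intro p hp hp2 i
      by_cases hi : i = j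
      · subst hi
        rw [ht'j]
        refine ⟨fun h => ?_, fun h => h.mul_left _⟩
        rcases (Nat.prime_iff_prime_int.1 hp).dvd_or_dvd h with h | h
        · exact absurd ((Nat.prime_dvd_prime_iff_eq hp Nat.prime_two).1 (by exact_mod_cast h)) hp2
        · exact h
      · rw [ht' i hi]
    have ht'0 : t' i0 = 0 := by rw [ht' i0 h0j.symm, h0]
    have hcore := aux_core a t' i0 ht'0 ha0 (M 0 1) ?_ ?_
    · obtain ⟨y, -, hy, hs⟩ := hcore
      refine aux_normal a t' y M hy ?_ hs
      have : ∑ i, a i * t' i = ∑ i, a i * t i + a j * t j := by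
        simp [t', mul_add, Finset.sum_add_distrib]
      rw [this]
      have hodd : ¬ (2 : ℤ) ∣ a j * t j := fun h => (Int.prime_two.dvd_or_dvd h).elim hj htj
      omega
    · intro p hp
      have hpp := Nat.prime_iff_prime_int.1 hp
      by_cases hp2 : p = 2
      · subst hp2
        refine ⟨l, fun h => ?_⟩
        rw [ht' l hjl.symm] at h
        exact (hpp.dvd_or_dvd h).elim hl htl
      by_cases hd : (p : ℤ) ∣ a i0
      · obtain ⟨i, j, -, hi, -, hti, -⟩ := h2 p hp hd
        exact ⟨i, fun h => (hpp.dvd_or_dvd h).elim hi (fun h => hti ((hdv p hp hp2 i).1 h))⟩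
      · obtain ⟨i, hi, hai⟩ := ha p hp i0
        exact ⟨i, fun h => (hpp.dvd_or_dvd h).elim hai
          (fun h => h1 p hp hd i hi ((hdv p hp hp2 i).1 h))⟩
    · intro p hp hd
      have hp2 : p ≠ 2 := by rintro rfl; exact hi0 hd
      apply aux_local a t' _ p hp
      obtain ⟨i, j, hij, hi, hj, hti, htj⟩ := h2 p hp hd
      exact ⟨i, j, hij, hi, hj, fun h => hti ((hdv p hp hp2 i).1 h), (hdv p hp hp2 j).2 htj⟩

/-- exactly two odd coefficients, upper right entry odd, even diagonal difference -/
lemma aux_two_odd {m : ℕ} (a : Fin m → ℤ) (i j c : Fin m) (hij : i ≠ j)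
    (hi : ¬ (2 : ℤ) ∣ a i) (hj : ¬ (2 : ℤ) ∣ a j) (he : ∀ k, k ≠ i → k ≠ j → (2 : ℤ) ∣ a k)
    (hci : c ≠ i) (hcj : c ≠ j) (hc : a c ≠ 0)
    (ha : ∀ p : ℕ, p.Prime → ∀ i, ∃ j, j ≠ i ∧ ¬ (p : ℤ) ∣ a j)
    (M : Matrix (Fin 2) (Fin 2) ℤ) (hM : (2 : ℤ) ∣ M 0 0 - M 1 1) (hM1 : ¬ (2 : ℤ) ∣ M 0 1) :
    ∃ A : Fin m → Matrix (Fin 2) (Fin 2) ℤ, M = ∑ i, a i • (A i) ^ 2 := by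
  have hmem : ∀ p : ℕ, p ∈ (a c).natAbs.primeFactors.erase 2 ↔ p ≠ 2 ∧ p.Prime ∧ (p : ℤ) ∣ a c := by
    intro p
    simp [hc, Int.natCast_dvd]
  obtain ⟨t, h0, h1, h2⟩ := aux_t a c ha _ (fun p hp => ((hmem p).1 hp).2)
  have htodd : ∀ k, k ≠ c → ¬ (2 : ℤ) ∣ t k := h1 2 Nat.prime_two (by simp)
  have hti := htodd i hci.symm
  have htj := htodd j hcj.symm
  have hcore := aux_core a t c h0 hc (M 0 1) ?_ ?_
  · obtain ⟨y, -, hy, hs⟩ := hcore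
    refine aux_normal a t y M hy ?_ hs
    have := aux_sum2 a t i j hij hi hj he
    omega
  · intro p hp
    have hpp := Nat.prime_iff_prime_int.1 hp
    by_cases hd : p ∈ (a c).natAbs.primeFactors.erase 2
    · obtain ⟨i, j, -, hi, -, hti, -⟩ := h2 p hd
      exact ⟨i, fun h => (hpp.dvd_or_dvd h).elim hi hti⟩
    · obtain ⟨i, hi, hai⟩ := ha p hp c
      exact ⟨i, fun h => (hpp.dvd_or_dvd h).elim hai (h1 p hp hd i hi)⟩
  · intro p hp hd
    by_cases hp2 : p = 2
    · subst hp2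
      refine ⟨Pi.single i 1, ?_, j, i, ?_⟩
      · simp only [Pi.single_apply, mul_ite, mul_one, mul_zero, Finset.sum_ite_eq',
          Finset.mem_univ, if_true]
        have hodd : ¬ (2 : ℤ) ∣ a i * t i := fun h => (Int.prime_two.dvd_or_dvd h).elim hi hti
        push_cast
        omega
      · simp only [Pi.single_apply, hij.symm, if_true, if_false, mul_one, mul_zero, sub_zero]
        intro h
        rcases Int.prime_two.dvd_or_dvd h with h | h
        · exact (Int.prime_two.dvd_or_dvd h).elim hj hi
        · exact htj h
    · exact aux_local a t _ p hp (h2 p ((hmem p).2 ⟨hp2, hp, hd⟩))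

/-- exactly two odd coefficients and one that is 2 mod 4 -/
lemma aux_two {m : ℕ} (a : Fin m → ℤ) (i j c : Fin m) (hij : i ≠ j)
    (hi : ¬ (2 : ℤ) ∣ a i) (hj : ¬ (2 : ℤ) ∣ a j) (he : ∀ k, k ≠ i → k ≠ j → (2 : ℤ) ∣ a k)
    (hci : c ≠ i) (hcj : c ≠ j) (hc : ¬ (4 : ℤ) ∣ a c)
    (ha : ∀ p : ℕ, p.Prime → ∀ i, ∃ j, j ≠ i ∧ ¬ (p : ℤ) ∣ a j)
    (M : Matrix (Fin 2) (Fin 2) ℤ) :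
    ∃ A : Fin m → Matrix (Fin 2) (Fin 2) ℤ, M = ∑ i, a i • (A i) ^ 2 := by
  have hc2 := he c hci hcj
  have hc0 : a c ≠ 0 := by rintro h; simp [h] at hc
  by_cases hM : (2 : ℤ) ∣ M 0 0 - M 1 1
  · by_cases h01 : (2 : ℤ) ∣ M 0 1
    · by_cases h10 : (2 : ℤ) ∣ M 1 0
      · obtain ⟨t, h0, -, -, h3⟩ := aux_default a c hc0 ha
        obtain ⟨β, hβ⟩ := h01
        obtain ⟨y, hy0, hy, hs⟩ := h3 β
        by_cases h4 : (4 : ℤ) ∣ M 0 0 - M 1 1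
        · exact aux_special1 a t y M (by rw [hy, hβ]) h10 h4 hs
        · exact aux_special2 a t y c M h0 hy0 (by rw [hy, hβ]) h10 (by omega) hs
      · obtain ⟨A, hA⟩ := aux_two_odd a i j c hij hi hj he hci hcj hc0 ha M.transpose hM h10
        refine ⟨fun i => (A i).transpose, ?_⟩
        have := congrArg Matrix.transpose hA
        rw [Matrix.transpose_transpose, Matrix.transpose_sum] at this
        rw [this]
        refine Finset.sum_congr rfl fun i _ => ?_
        rw [Matrix.transpose_smul, Matrix.transpose_pow]
    · exact aux_two_odd a i j c hij hi hj he hci hcj hc0 ha M hM h01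
  · obtain ⟨t, h0, -, h2, h3⟩ := aux_default a c hc0 ha
    obtain ⟨y, -, hy, hs⟩ := h3 (M 0 1)
    refine aux_normal a t y M hy ?_ hs
    obtain ⟨i', j', hij', hi', hj', hti, htj⟩ := h2 2 Nat.prime_two hc2
    push_cast at hi' hj' hti htj
    have := aux_sum2 a t i' j' hij' hi' hj' (by
      intro k hk hk'
      apply he
      · grind
      · grind)
    omega

/-- necessity, part 1 -/
lemma aux_nec1 {m : ℕ} (a : Fin m → ℤ)
    (h : ∀ M : Matrix (Fin 2) (Fin 2) ℤ,
        ∃ A : Fin m → Matrix (Fin 2) (Fin 2) ℤ, M = ∑ i, a i • (A i) ^ 2)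
    (p : ℕ) (hp : p.Prime) (i : Fin m) : ∃ j, j ≠ i ∧ ¬ (p : ℤ) ∣ a j := by
  by_contra! hcon
  have hpp := Nat.prime_iff_prime_int.1 hp
  obtain ⟨A, hA⟩ := h !![0, 1; 0, 0]
  have key : ∀ k l, (p : ℤ) ∣ (!![0, 1; 0, 0] : Matrix (Fin 2) (Fin 2) ℤ) k l
      - a i * (A i ^ 2) k l := by
    intro k l
    rw [hA, Matrix.sum_apply, ← Finset.add_sum_erase _ _ (Finset.mem_univ i)]
    simp only [Matrix.smul_apply, smul_eq_mul, add_sub_cancel_left]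
    exact Finset.dvd_sum fun j hj => (hcon j (Finset.ne_of_mem_erase hj)).mul_right _
  have k00 := key 0 0
  have k01 := key 0 1
  have k10 := key 1 0
  have k11 := key 1 1
  simp [pow_two, Matrix.mul_apply] at k00 k01 k10 k11
  generalize a i = b at *
  generalize A i 0 0 = x at *
  generalize A i 0 1 = y at *
  generalize A i 1 0 = z at *
  generalize A i 1 1 = w at *
  have hu : ∀ n : ℤ, n ∣ b * (x * y + y * w) → ¬ (p : ℤ) ∣ n := by
    intro n hn hpn
    have := dvd_add k01 (hpn.trans hn)
    rw [sub_add_cancel] at this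
    exact hpp.not_isUnit (isUnit_of_dvd_one this)
  have hb : ¬ (p : ℤ) ∣ b := hu b (Dvd.intro _ rfl)
  have ht : ¬ (p : ℤ) ∣ x + w := hu _ ⟨b * y, by ring⟩
  have hz : (p : ℤ) ∣ z := by
    have h1 : (p : ℤ) ∣ b * ((x + w) * z) := by
      have e : b * ((x + w) * z) = b * (z * x + w * z) := by ring
      rw [e]
      exact k10
    exact (hpp.dvd_or_dvd ((hpp.dvd_or_dvd h1).resolve_left hb)).resolve_left ht
  have hx : (p : ℤ) ∣ x := by
    have h1 := (hpp.dvd_or_dvd k00).resolve_left hb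
    have h2 : (p : ℤ) ∣ x * x := (dvd_add_left (hz.mul_left y)).1 h1
    exact (hpp.dvd_or_dvd h2).elim id id
  have hw : (p : ℤ) ∣ w := by
    have h1 := (hpp.dvd_or_dvd k11).resolve_left hb
    have h2 : (p : ℤ) ∣ w * w := (dvd_add_right (hz.mul_right y)).1 h1
    exact (hpp.dvd_or_dvd h2).elim id id
  exact ht (dvd_add hx hw)

lemma aux_mod4 (a b x y z w x' y' z' w' n : ℤ) (ha : ¬ (2 : ℤ) ∣ a) (hb : ¬ (2 : ℤ) ∣ b)
    (hn : ¬ (4 : ℤ) ∣ a + b - 2 - 2 * n)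
    (h00 : (4 : ℤ) ∣ 2 + n - (a * (x * x + y * z) + b * (x' * x' + y' * z')))
    (h01 : (4 : ℤ) ∣ a * (x * y + y * w) + b * (x' * y' + y' * w'))
    (h10 : (4 : ℤ) ∣ a * (z * x + w * z) + b * (z' * x' + w' * z'))
    (h11 : (4 : ℤ) ∣ n - (a * (z * y + w * w) + b * (z' * y' + w' * w'))) : False := by
  obtain ⟨a1, rfl⟩ : ∃ c, a = 2 * c + 1 := ⟨a / 2, by omega⟩
  obtain ⟨b1, rfl⟩ : ∃ c, b = 2 * c + 1 := ⟨b / 2, by omega⟩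
  obtain ⟨e1, h00⟩ := h00
  obtain ⟨e2, h01⟩ := h01
  obtain ⟨e3, h10⟩ := h10
  obtain ⟨e4, h11⟩ := h11
  obtain ⟨t, rfl⟩ : ∃ t, x = t - w := ⟨x + w, by ring⟩
  obtain ⟨t', rfl⟩ : ∃ t, x' = t - w' := ⟨x' + w', by ring⟩
  have D : 2 - ((2 * a1 + 1) * (t * (t - 2 * w)) + (2 * b1 + 1) * (t' * (t' - 2 * w'))) =
    4 * (e1 - e4) := by linear_combination h00 - h11
  rcases Int.even_or_odd' t with ⟨s, rfl | rfl⟩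
  · rcases Int.even_or_odd' t' with ⟨s', rfl | rfl⟩
    · ring_nf at D; omega
    · ring_nf at D
      have := Int.even_mul_succ_self s'
      ring_nf at this
      omega
  · rcases Int.even_or_odd' t' with ⟨s', rfl | rfl⟩
    · ring_nf at D
      omega
    · obtain ⟨v, rfl⟩ : ∃ v, y' = y + 2 * v := by
        obtain ⟨v, hv⟩ : (2 : ℤ) ∣ y' - y := by
          have : y + y' = 2 * (2 * e2 - (a1 * (2 * s + 1) + s) * y - (b1 * (2 * s' + 1) + s') * y') := by
            linear_combination h01
          omega
        exact ⟨v, by omega⟩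
      obtain ⟨u, rfl⟩ : ∃ v, z' = z + 2 * v := by
        obtain ⟨v, hv⟩ : (2 : ℤ) ∣ z' - z := by
          have : z + z' = 2 * (2 * e3 - (a1 * (2 * s + 1) + s) * z - (b1 * (2 * s' + 1) + s') * z') := by
            linear_combination h10
          omega
        exact ⟨v, by omega⟩
      apply hn
      obtain ⟨q, hq⟩ := (Int.even_mul_pred_self w).two_dvd
      obtain ⟨q', hq'⟩ := (Int.even_mul_pred_self w').two_dvd
      refine ⟨-(e1 + e4) - (2 * a1 + 1) * (s * s + s - s * w + q)
        - (2 * b1 + 1) * (s' * s' + s' - s' * w' + q' + y * u + v * z + 2 * u * v)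
        - (a1 + b1 + 1) * (y * z), ?_⟩
      linear_combination -h00 - h11 - 2 * (2 * a1 + 1) * hq - 2 * (2 * b1 + 1) * hq'

lemma aux_nec2 {m : ℕ} (a : Fin m → ℤ)
    (h : ∀ M : Matrix (Fin 2) (Fin 2) ℤ,
        ∃ A : Fin m → Matrix (Fin 2) (Fin 2) ℤ, M = ∑ i, a i • (A i) ^ 2)
    (i j : Fin m) (hij : i ≠ j) (hi : ¬ (2 : ℤ) ∣ a i) (hj : ¬ (2 : ℤ) ∣ a j) :
    ∃ k, k ≠ i ∧ k ≠ j ∧ ¬ (4 : ℤ) ∣ a k := by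
  by_contra! hcon
  obtain ⟨n, hn⟩ : ∃ n : ℤ, ¬ (4 : ℤ) ∣ a i + a j - 2 - 2 * n := by
    by_cases h4 : (4 : ℤ) ∣ a i + a j
    · exact ⟨0, by omega⟩
    · exact ⟨1, by omega⟩
  obtain ⟨A, hA⟩ := h !![2 + n, 0; 0, n]
  have key : ∀ k l, (4 : ℤ) ∣ (!![2 + n, 0; 0, n] : Matrix (Fin 2) (Fin 2) ℤ) k l
      - (a i * (A i ^ 2) k l + a j * (A j ^ 2) k l) := by
    intro k l
    rw [hA, Matrix.sum_apply, ← Finset.add_sum_erase _ _ (Finset.mem_univ i),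
      ← Finset.add_sum_erase _ _ (Finset.mem_erase.2 ⟨hij.symm, Finset.mem_univ j⟩)]
    simp only [Matrix.smul_apply, smul_eq_mul, ← add_assoc, add_sub_cancel_left]
    refine Finset.dvd_sum fun k hk => Dvd.dvd.mul_right (hcon k ?_ ?_) _
    · exact Finset.ne_of_mem_erase (Finset.mem_of_mem_erase hk)
    · exact Finset.ne_of_mem_erase hk
  have k00 := key 0 0
  have k01 := key 0 1
  have k10 := key 1 0
  have k11 := key 1 1
  simp only [pow_two, Matrix.mul_apply, Fin.sum_univ_two] at k00 k01 k10 k11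
  refine aux_mod4 (a i) (a j) _ _ _ _ _ _ _ _ n hi hj hn k00 ?_ ?_ k11
  · have := (dvd_neg.2 k01)
    simpa using this
  · have := (dvd_neg.2 k10)
    simpa using this

theorem stmt5 (m : ℕ) (hm : 1 ≤ m) (a : Fin m → ℤ) :
    (∀ M : Matrix (Fin 2) (Fin 2) ℤ,
        ∃ A : Fin m → Matrix (Fin 2) (Fin 2) ℤ, M = ∑ i, a i • (A i) ^ 2) ↔
      ((∀ p : ℕ, p.Prime → (Finset.univ.filter fun i => (p : ℤ) ∣ a i).card ≤ m - 2) ∧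
        3 ≤ (Finset.univ.filter fun i => ¬ (4 ∣ a i)).card) := by
  have hcard : ∀ p : ℕ, (Finset.univ.filter fun i => (p : ℤ) ∣ a i).card
      + (Finset.univ.filter fun i => ¬ (p : ℤ) ∣ a i).card = m := by
    intro p
    rw [Finset.card_filter_add_card_filter_not]
    simp
  constructor
  · intro h
    have h1 := aux_nec1 a h
    have htwo : ∀ p : ℕ, p.Prime → ∃ i j, i ≠ j ∧ ¬ (p : ℤ) ∣ a i ∧ ¬ (p : ℤ) ∣ a j := by
      intro p hp
      obtain ⟨i, -, hi⟩ := h1 p hp ⟨0, hm⟩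
      obtain ⟨j, hj, hj'⟩ := h1 p hp i
      exact ⟨i, j, hj.symm, hi, hj'⟩
    constructor
    · intro p hp
      obtain ⟨i, j, hij, hi, hj⟩ := htwo p hp
      have : 1 < (Finset.univ.filter fun i => ¬ (p : ℤ) ∣ a i).card :=
        Finset.one_lt_card.2 ⟨i, by simp [hi], j, by simp [hj], hij⟩
      have := hcard p
      omega
    · obtain ⟨i, j, hij, hi, hj⟩ := htwo 2 Nat.prime_two
      push_cast at hi hj
      obtain ⟨k, hki, hkj, hk⟩ := aux_nec2 a h i j hij hi hj
      have : 2 < (Finset.univ.filter fun i => ¬ ((4 : ℤ) ∣ a i)).card := by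
        refine Finset.two_lt_card.2 ⟨i, ?_, j, ?_, k, ?_, hij, hki.symm, hkj.symm⟩
        · simp; omega
        · simp; omega
        · simp [hk]
      exact this
  · rintro ⟨h1, h2⟩ M
    have hm3 : 3 ≤ m := h2.trans ((Finset.card_le_univ _).trans (by simp))
    have hgt : ∀ p : ℕ, p.Prime → 1 < (Finset.univ.filter fun i => ¬ (p : ℤ) ∣ a i).card := by
      intro p hp
      have := hcard p
      have := h1 p hp
      omega
    have ha : ∀ p : ℕ, p.Prime → ∀ i, ∃ j, j ≠ i ∧ ¬ (p : ℤ) ∣ a j := by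
      intro p hp i
      obtain ⟨j, hj, hji⟩ := Finset.exists_mem_ne (hgt p hp) i
      exact ⟨j, hji, by simpa using hj⟩
    obtain ⟨i, hi, j, hj, hij⟩ := Finset.one_lt_card.1 (hgt 2 Nat.prime_two)
    simp only [Finset.mem_filter, Finset.mem_univ, true_and, Nat.cast_ofNat] at hi hj
    by_cases h3 : ∃ l, l ≠ i ∧ l ≠ j ∧ ¬ (2 : ℤ) ∣ a l
    · obtain ⟨l, hli, hlj, hl⟩ := h3
      exact aux_three a i j l hij.symm hli hlj.symm hi hj hl ha M
    · push Not at h3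
      have : ∃ c ∈ (Finset.univ.filter fun i => ¬ ((4 : ℤ) ∣ a i)), c ∉ ({i, j} : Finset (Fin m)) :=
        Finset.exists_mem_notMem_of_card_lt_card (lt_of_le_of_lt Finset.card_le_two h2)
      obtain ⟨c, hc, hc'⟩ := this
      simp at hc hc'
      exact aux_two a i j c hij hi hj h3 hc'.1 hc'.2 hc ha M
end

section
/- Every n×n integer matrix with trace zero is a commutator: if tr(M) = 0 for M ∈ Mₙ(ℤ), then there exist X, Y ∈ Mₙ(ℤ) with M = XY − YX. -/
/-- Lift a unit modulo `e` to an integer which is moreover coprime to `M`. -/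
lemma exists_coprime_lift (a e M : ℤ) (h : IsCoprime a e) (he : e ≠ 0) (hM : M ≠ 0) :
    ∃ u : ℤ, e ∣ u - a ∧ IsCoprime u M := by
  have hne : (e.natAbs * M.natAbs) ≠ 0 := by
    simp [he, hM]
  have : NeZero (e.natAbs * M.natAbs) := ⟨hne⟩
  have hd : e.natAbs ∣ e.natAbs * M.natAbs := Dvd.intro _ rfl
  have hunit : IsUnit ((a : ℤ) : ZMod e.natAbs) := by
    rw [ZMod.coe_int_isUnit_iff_isCoprime]
    rw [Int.isCoprime_iff_gcd_eq_one] at h ⊢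
    simpa [Int.gcd, Int.natAbs_abs, Nat.gcd_comm] using h
  obtain ⟨w, hw⟩ := ZMod.unitsMap_surjective hd hunit.unit
  obtain ⟨u, hu⟩ := ZMod.intCast_surjective (w : ZMod (e.natAbs * M.natAbs))
  refine ⟨u, ?_, ?_⟩
  · have h1 : ((u : ℤ) : ZMod e.natAbs) = (a : ZMod e.natAbs) := by
      have h2 := congrArg (Units.val) hw
      rw [ZMod.unitsMap_val, ← hu] at h2
      simpa using h2
    rw [eq_comm, ZMod.intCast_eq_intCast_iff_dvd_sub] at h1
    exact Int.natAbs_dvd.mp h1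
  · have h3 : IsUnit ((u : ℤ) : ZMod (e.natAbs * M.natAbs)) := by rw [hu]; exact w.isUnit
    rw [ZMod.coe_int_isUnit_iff_isCoprime, isCoprime_comm] at h3
    push_cast at h3
    have h4 := h3.of_mul_right_right
    rw [Int.isCoprime_iff_gcd_eq_one] at h4 ⊢
    simpa [Int.gcd, Int.natAbs_abs, Nat.gcd_comm] using h4

lemma core_aux (a b D e : ℤ) (he : e ≠ 0) (h : IsCoprime D e) (hb : b ≠ 0) :
    ∃ t u v : ℤ, t * e ∣ u * v - 1 ∧ t * e ∣ u * a + v * b + t * D := by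
  obtain ⟨p, q, hpq⟩ := h
  have h1 : IsCoprime (-p) e := ⟨-D, q, by linear_combination hpq⟩
  obtain ⟨u, ⟨k, hk⟩, hub⟩ := exists_coprime_lift (-p) e b h1 he hb
  have hue : IsCoprime u e := ⟨-D, q + k * D, by linear_combination hpq - D * hk⟩
  have hut : IsCoprime u (u ^ 2 * a + b) := by
    have := (IsCoprime.add_mul_left_right_iff (x := u) (y := b) (z := u * a)).mpr hub
    rwa [show b + u * (u * a) = u ^ 2 * a + b by ring] at this
  have hc := hut.mul_right hue
  obtain ⟨v, w, hvw⟩ := id hc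
  refine ⟨u ^ 2 * a + b, u, v, ⟨-w, by linear_combination hvw⟩, ?_⟩
  apply hc.symm.dvd_of_dvd_mul_left
  refine ⟨q + k * D - w * b, ?_⟩
  linear_combination b * hvw + (-(u ^ 2 * a + b)) * hpq + (u ^ 2 * a + b) * D * hk

lemma core (a b D e : ℤ) (he : e ≠ 0) (h : IsCoprime D e) :
    ∃ t u v : ℤ, t * e ∣ u * v - 1 ∧ t * e ∣ u * a + v * b + t * D := by
  by_cases hb : b = 0
  · by_cases ha : a = 0
    · exact ⟨0, 1, 1, by simp, by simp [ha, hb]⟩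
    · obtain ⟨t, u, v, h1, h2⟩ := core_aux b a D e he h ha
      exact ⟨t, v, u, by rwa [mul_comm v u], by rwa [add_comm (v * a)]⟩
  · exact core_aux a b D e he h hb

lemma number_lemma (n : ℕ) (h : ℕ → ℤ) (D : ℤ) :
    ∃ (x : ℤ) (s : ℕ → ℤ), x * D + ∑ i ∈ Finset.range n, s i * h i = 0 ∧
      (∀ i, x ∣ s i * s (i + 1) - 1) ∧ IsCoprime (s 0) x := by
  by_cases h0 : ∀ i ∈ Finset.range n, h i = 0
  · refine ⟨0, fun _ => 1, ?_, by simp, isCoprime_one_left⟩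
    simpa using Finset.sum_eq_zero h0
  push Not at h0
  obtain ⟨i0, hi0, hne⟩ := h0
  obtain ⟨m, hm, hm1⟩ := (Finset.range n).extract_gcd h ⟨i0, hi0⟩
  obtain ⟨l, hl⟩ := Finset.gcd_eq_sum_mul (Finset.range n) m
  rw [hm1] at hl
  set H := (Finset.range n).gcd h
  have hH : H ≠ 0 := by
    intro h'; apply hne; rw [hm i0 hi0, h', zero_mul]
  obtain ⟨D', e, hcop, hD, hHe⟩ : ∃ D' e : ℤ, IsCoprime D' e ∧ D = GCDMonoid.gcd D H * D' ∧
      H = GCDMonoid.gcd D H * e := by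
    obtain ⟨D', e, h1, h2, hu⟩ := extract_gcd D H
    exact ⟨D', e, (gcd_isUnit_iff D' e).mp hu, h1, h2⟩
  set g := GCDMonoid.gcd D H
  have he : e ≠ 0 := by
    intro h'; apply hH; rw [hHe, h', mul_zero]
  obtain ⟨t, u, v, huv, L, hL⟩ := core (∑ i ∈ Finset.range n, if Even i then m i else 0)
    (∑ i ∈ Finset.range n, if Even i then 0 else m i) D' e he hcop
  refine ⟨t * e, fun i => (if Even i then u else v) - t * e * (L * l i), ?_, ?_, ?_⟩
  · have h1 : ∑ i ∈ Finset.range n, ((if Even i then u else v) - t * e * (L * l i)) * h i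
      = H * (u * (∑ i ∈ Finset.range n, if Even i then m i else 0)
        + v * (∑ i ∈ Finset.range n, if Even i then 0 else m i)
        - t * e * L * ∑ i ∈ Finset.range n, m i * l i) := by
      simp only [Finset.mul_sum, ← Finset.sum_add_distrib, ← Finset.sum_sub_distrib]
      refine Finset.sum_congr rfl fun i hi => ?_
      rw [hm i hi]
      split_ifs <;> ring
    rw [h1, ← hl]
    rw [hD]
    linear_combination H * hL + (-(t * D')) * hHe
  · intro i
    obtain ⟨k, hk⟩ := huv
    by_cases hi : Even i
    · have : ¬ Even (i + 1) := by simpa [Nat.even_add_one] using hi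
      simp only [hi, this, if_true, if_false]
      exact ⟨k - u * (L * l (i + 1)) - v * (L * l i) + t * e * (L * l i) * (L * l (i + 1)), by
        linear_combination hk⟩
    · have : Even (i + 1) := by simpa [Nat.even_add_one] using hi
      simp only [hi, this, if_true, if_false]
      exact ⟨k - v * (L * l (i + 1)) - u * (L * l i) + t * e * (L * l i) * (L * l (i + 1)), by
        linear_combination hk⟩
  · obtain ⟨k, hk⟩ := huv
    refine ⟨v, -k + v * L * l 0, ?_⟩
    simp only [Even.zero, if_true]
    linear_combination hk

open Matrix in
lemma krylov (n : ℕ) (X A : Matrix (Fin (n + 1)) (Fin (n + 1)) ℤ) (lam : ℕ → ℤ)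
    (l : ℕ → Fin (n + 1) → ℤ) (hl : ∀ j, l (j + 1) = X *ᵥ l j - lam j • l j)
    (htr : ∀ r, (X ^ r * A).trace = 0) :
    ∃ Y, (Matrix.of fun i j : Fin (n + 1) => l j i).det • A = X * Y - Y * X := by
  set L : Matrix (Fin (n + 1)) (Fin (n + 1)) ℤ := Matrix.of fun i j => l j i with hLdef
  set κ := L.det with hκ
  by_cases hκ0 : κ = 0
  · exact ⟨0, by simp [hκ0]⟩
  have hX : ∀ j, X *ᵥ l j = l (j + 1) + lam j • l j := fun j => by rw [hl j]; simp
  have hcol : ∀ (B : Matrix (Fin (n + 1)) (Fin (n + 1)) ℤ) (i j : Fin (n + 1)),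
      (B * L) i j = (B *ᵥ l j) i := fun B i j => rfl
  let y : ℕ → Fin (n + 1) → ℤ := fun j =>
    Nat.rec 0 (fun j yj => X *ᵥ yj - lam j • yj - A *ᵥ l j) j
  have hy : ∀ j, y (j + 1) = X *ᵥ y j - lam j • y j - A *ᵥ l j := fun j => rfl
  let Y' : Matrix (Fin (n + 1)) (Fin (n + 1)) ℤ := Matrix.of fun i j => y j i
  obtain ⟨Y, hYdef⟩ : ∃ Y, Y = Y' * L.adjugate := ⟨_, rfl⟩
  have hY : ∀ j : ℕ, j < n + 1 → Y *ᵥ l j = κ • y j := by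
    intro j hj
    ext i
    have h1 := hcol Y i ⟨j, hj⟩
    rw [show Y * L = κ • Y' by
      rw [hYdef, Matrix.mul_assoc, Matrix.adjugate_mul, Matrix.mul_smul, Matrix.mul_one]] at h1
    exact h1.symm
  set Δ := κ • A - (X * Y - Y * X) with hΔdef
  have hΔ : ∀ j : ℕ, j < n → Δ *ᵥ l j = 0 := by
    intro j hj
    rw [hΔdef, Matrix.sub_mulVec, Matrix.sub_mulVec, ← Matrix.mulVec_mulVec, ← Matrix.mulVec_mulVec,
      hY j (by omega), hX j, Matrix.mulVec_add, Matrix.mulVec_smul, Matrix.mulVec_smul,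
      hY j (by omega), hY (j + 1) (by omega), hy j, Matrix.smul_mulVec]
    module
  have htrΔ : ∀ r, (X ^ r * Δ).trace = 0 := by
    intro r
    rw [hΔdef, Matrix.mul_sub, Matrix.trace_sub, Matrix.mul_smul, Matrix.trace_smul, htr r,
      Matrix.mul_sub, Matrix.trace_sub]
    have : (X ^ r * (X * Y)).trace = (X ^ r * (Y * X)).trace := by
      rw [← Matrix.mul_assoc (X ^ r) Y X, Matrix.trace_mul_comm (X ^ r * Y) X, ← Matrix.mul_assoc,
        ← Matrix.mul_assoc, (Commute.pow_self X r).eq]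
    rw [this]; simp
  set δ := Δ *ᵥ l n with hδ
  -- the last coordinate functional
  let φ : (Fin (n + 1) → ℤ) → ℤ := fun z => (L.adjugate *ᵥ z) (Fin.last n)
  have hadj : ∀ (j : ℕ) (hj : j < n + 1), L.adjugate *ᵥ l j = Pi.single ⟨j, hj⟩ κ := by
    intro j hj
    ext i
    have h1 := hcol L.adjugate i ⟨j, hj⟩
    rw [Matrix.adjugate_mul] at h1
    rw [← h1]
    simp [Matrix.one_apply, Pi.single_apply, hκ]
  have hφδ : ∀ r, φ (X ^ r *ᵥ δ) = 0 := by
    intro r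
    have h1 : (L.adjugate * (X ^ r * (Δ * L))).trace = 0 := by
      rw [Matrix.trace_mul_comm, ← Matrix.mul_assoc, Matrix.mul_assoc, Matrix.mul_adjugate,
        Matrix.mul_smul, Matrix.mul_one, Matrix.trace_smul, htrΔ r, smul_zero]
    rw [Matrix.trace, Fin.sum_univ_castSucc] at h1
    have h2 : ∀ j : Fin (n + 1), (L.adjugate * (X ^ r * (Δ * L))) j j
        = (L.adjugate *ᵥ (X ^ r *ᵥ (Δ *ᵥ l j))) j := by
      intro j
      rw [← Matrix.mul_assoc, ← Matrix.mul_assoc, hcol, Matrix.mulVec_mulVec, Matrix.mulVec_mulVec,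
        Matrix.mul_assoc]
    simp only [Matrix.diag_apply, h2] at h1
    rw [Finset.sum_eq_zero, zero_add] at h1
    · simpa [φ, hδ] using h1
    · intro j _
      rw [Fin.val_castSucc, hΔ j j.2]
      simp
  have hφ : ∀ m j, m + j ≤ n → φ (X ^ m *ᵥ l j) = if m + j = n then κ else 0 := by
    intro m
    induction m with
    | zero =>
      intro j hj
      simp only [φ, pow_zero, Matrix.one_mulVec, zero_add]
      rw [hadj j (by omega)]
      simp [Pi.single_apply, Fin.ext_iff, eq_comm]
    | succ m ih =>
      intro j hj
      have h1 := ih (j + 1) (by omega)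
      have h2 := ih j (by omega)
      rw [if_neg (by omega)] at h2
      rw [pow_succ, ← Matrix.mulVec_mulVec, hX j, Matrix.mulVec_add, Matrix.mulVec_smul]
      simp only [φ, Matrix.mulVec_add, Matrix.mulVec_smul, Pi.add_apply, Pi.smul_apply] at h1 h2 ⊢
      rw [h1, h2]
      simp [add_assoc, add_comm 1 j]
  set c := L.adjugate *ᵥ δ with hc
  have hκδ : κ • δ = ∑ j : Fin (n + 1), c j • l j := by
    have h1 : L *ᵥ c = κ • δ := by
      rw [hc, Matrix.mulVec_mulVec, Matrix.mul_adjugate, Matrix.smul_mulVec, Matrix.one_mulVec]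
    rw [← h1]
    ext i
    simp only [Matrix.mulVec, dotProduct, hLdef, Matrix.of_apply, Finset.sum_apply, Pi.smul_apply,
      smul_eq_mul]
    exact Finset.sum_congr rfl fun j _ => mul_comm _ _
  have hcz : ∀ m, ∀ hm : m ≤ n, c ⟨n - m, by omega⟩ = 0 := by
    intro m
    induction m using Nat.strong_induction_on with
    | _ m ih =>
      intro hm
      have h1 : φ (X ^ m *ᵥ (κ • δ)) = 0 := by
        have := hφδ m
        simp only [φ, Matrix.mulVec_smul, Pi.smul_apply] at this ⊢
        rw [this]; simp
      rw [hκδ] at h1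
      have h2 : φ (X ^ m *ᵥ ∑ j : Fin (n + 1), c j • l j)
          = ∑ j : Fin (n + 1), c j * φ (X ^ m *ᵥ l j) := by
        simp only [φ, Matrix.mulVec_sum, Matrix.mulVec_smul, Finset.sum_apply, Pi.smul_apply,
          smul_eq_mul]
      rw [h2, Finset.sum_eq_single ⟨n - m, by omega⟩, hφ _ _ (by simp; omega),
        if_pos (by simp; omega)] at h1
      · exact (mul_eq_zero.mp h1).resolve_right hκ0
      · intro j _ hj
        rcases lt_or_gt_of_ne (fun h => hj (Fin.ext h) : (j : ℕ) ≠ n - m) with h | h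
        · rw [hφ _ _ (by omega), if_neg (by omega), mul_zero]
        · have h3 := ih (n - j) (by omega) (by omega)
          rw [show (⟨n - (n - j), by omega⟩ : Fin (n + 1)) = j from Fin.ext (by simp; omega)] at h3
          rw [h3, zero_mul]
      · simp
  have hc0 : c = 0 := by
    ext j
    have h3 := hcz (n - j) (by omega)
    rwa [show (⟨n - (n - j), by omega⟩ : Fin (n + 1)) = j from Fin.ext (by simp; omega)] at h3
  have hδ0 : δ = 0 := by
    rw [hc0] at hκδ
    simp only [Pi.zero_apply, zero_smul, Finset.sum_const_zero] at hκδ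
    exact (smul_eq_zero.mp hκδ).resolve_left hκ0
  have hΔL : Δ * L = 0 := by
    ext i j
    rw [hcol]
    by_cases hj : (j : ℕ) < n
    · rw [hΔ j hj]; rfl
    · rw [show (j : ℕ) = n by omega, ← hδ, hδ0]; rfl
  have hΔ0 : Δ = 0 := by
    have h1 : Δ * L * L.adjugate = κ • Δ := by
      rw [Matrix.mul_assoc, Matrix.mul_adjugate, Matrix.mul_smul, Matrix.mul_one]
    rw [hΔL, Matrix.zero_mul] at h1
    exact (smul_eq_zero.mp h1.symm).resolve_left hκ0
  exact ⟨Y, sub_eq_zero.mp hΔ0⟩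


/-- Alternating diagonal `0, x, 0, x, …`. -/
def altDiag (x : ℤ) (i : ℕ) : ℤ := if Even i then 0 else x

lemma altDiag_add (x : ℤ) (i : ℕ) : altDiag x (i + 1) = x - altDiag x i := by
  unfold altDiag
  by_cases h : Even i <;> simp [h, Nat.even_add_one]

lemma altDiag_sq (x : ℤ) (i : ℕ) : altDiag x i * altDiag x i = x * altDiag x i := by
  unfold altDiag
  by_cases h : Even i <;> simp [h]

/-- Entries of the banded lower triangular matrix. -/
def bandEntry (x : ℤ) (s c : ℕ → ℤ) (i j : ℕ) : ℤ :=
  if i = j then altDiag x i else if i = j + 1 then s j else if i = j + 2 then c j else 0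

/-- The action of the banded matrix on sequences. -/
def bandOp (x : ℤ) (s c : ℕ → ℤ) (z : ℕ → ℤ) : ℕ → ℤ
  | 0 => altDiag x 0 * z 0
  | 1 => altDiag x 1 * z 1 + s 0 * z 0
  | (i + 2) => altDiag x (i + 2) * z (i + 2) + s (i + 1) * z (i + 1) + c i * z i

lemma sum_bandEntry (x : ℤ) (s c : ℕ → ℤ) (z : ℕ → ℤ) (N i : ℕ) (hi : i < N) :
    ∑ j ∈ Finset.range N, bandEntry x s c i j * z j = bandOp x s c z i := by
  match i, hi with
  | 0, hi =>
    rw [Finset.sum_eq_single 0]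
    · simp [bandEntry, bandOp]
    · intro j _ hj
      simp [bandEntry, hj.symm]
    · intro h; simp at h; omega
  | 1, hi =>
    have h1 : ∀ j ∈ Finset.range N, bandEntry x s c 1 j * z j =
        (if j = 1 then altDiag x 1 * z 1 else 0) + (if j = 0 then s 0 * z 0 else 0) := by
      intro j _
      unfold bandEntry
      by_cases h1 : j = 1
      · subst h1; simp
      by_cases h0 : j = 0
      · subst h0; simp
      rw [if_neg (by omega), if_neg (by omega), if_neg (by omega), if_neg h1, if_neg h0]
      ring
    rw [Finset.sum_congr rfl h1, Finset.sum_add_distrib, Finset.sum_ite_eq', Finset.sum_ite_eq',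
      if_pos (by simp; omega), if_pos (by simp; omega)]
    rfl
  | (i + 2), hi =>
    have h1 : ∀ j ∈ Finset.range N, bandEntry x s c (i + 2) j * z j =
        (if j = i + 2 then altDiag x (i + 2) * z (i + 2) else 0) +
        (if j = i + 1 then s (i + 1) * z (i + 1) else 0) + (if j = i then c i * z i else 0) := by
      intro j _
      unfold bandEntry
      by_cases h2 : j = i + 2
      · subst h2; simp
      by_cases h1 : j = i + 1
      · subst h1; simp
      by_cases h0 : j = i
      · subst h0; simp
      rw [if_neg (by omega), if_neg (by omega), if_neg (by omega), if_neg h2, if_neg h1, if_neg h0]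
      ring
    rw [Finset.sum_congr rfl h1, Finset.sum_add_distrib, Finset.sum_add_distrib,
      Finset.sum_ite_eq', Finset.sum_ite_eq', Finset.sum_ite_eq',
      if_pos (by simp; omega), if_pos (by simp; omega), if_pos (by simp; omega)]
    rfl

lemma bandOp_sub_smul (x : ℤ) (s c : ℕ → ℤ) (z w : ℕ → ℤ) (a : ℤ) (i : ℕ) :
    bandOp x s c (fun k => z k - a * w k) i = bandOp x s c z i - a * bandOp x s c w i := by
  match i with
  | 0 => simp only [bandOp]; ring
  | 1 => simp only [bandOp]; ring
  | (i + 2) => simp only [bandOp]; ring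

lemma bandOp_filt (x : ℤ) (s c : ℕ → ℤ) (z : ℕ → ℤ) (j : ℕ) (hz : ∀ k < j, z k = 0) :
    ∀ i < j + 1, bandOp x s c z i = altDiag x j * z i := by
  intro i hi
  match i, hi with
  | 0, hi =>
    rcases Nat.eq_zero_or_pos j with h | h
    · subst h; rfl
    · simp [bandOp, hz 0 h]
  | 1, hi =>
    have h0 := hz 0 (by omega)
    rcases Nat.lt_or_ge 1 j with h | h
    · simp [bandOp, h0, hz 1 h]
    · have : j = 1 := by omega
      subst this; simp [bandOp, h0]
  | (i + 2), hi =>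
    have h0 := hz i (by omega)
    have h1 := hz (i + 1) (by omega)
    rcases Nat.lt_or_ge (i + 2) j with h | h
    · simp [bandOp, h0, h1, hz _ h]
    · have : j = i + 2 := by omega
      subst this; simp [bandOp, h0, h1]

lemma bandOp_quad (x : ℤ) (s c : ℕ → ℤ) (hq : ∀ i, s i * s (i + 1) + c i * (2 * altDiag x i - x) = 1)
    (z : ℕ → ℤ) (j : ℕ) (hz : ∀ k < j, z k = 0) :
    (∀ i < j + 2, bandOp x s c (bandOp x s c z) i = x * bandOp x s c z i) ∧
    bandOp x s c (bandOp x s c z) (j + 2) - x * bandOp x s c z (j + 2) = z j := by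
  have key : ∀ i, (∀ k < i, z k = 0) →
      bandOp x s c (bandOp x s c z) (i + 2) - x * bandOp x s c z (i + 2) = z i := by
    intro i hzi
    have hqi := hq i
    have e1 := altDiag_add x i
    have e2 := altDiag_add x (i + 1)
    have e3 := altDiag_sq x i
    match i, hzi, hqi, e1, e2, e3 with
    | 0, hzi, hqi, e1, e2, e3 =>
      simp only [bandOp, zero_add] at *
      rw [e2, e1]
      linear_combination z 0 * hqi + z 2 * e3
    | 1, hzi, hqi, e1, e2, e3 =>
      have h0 := hzi 0 (by omega)
      simp only [bandOp, zero_add, h0] at *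
      norm_num only at *
      rw [e2, e1]
      linear_combination z 1 * hqi + z 3 * e3
    | (i + 2), hzi, hqi, e1, e2, e3 =>
      have h0 := hzi i (by omega)
      have h1 := hzi (i + 1) (by omega)
      simp only [bandOp, h0, h1] at *
      rw [e2, e1]
      linear_combination z (i + 2) * hqi + z (i + 4) * e3
  refine ⟨?_, key j hz⟩
  intro i hi
  match i, hi with
  | 0, hi => simp [bandOp, altDiag]
  | 1, hi => simp [bandOp, altDiag]
  | (i + 2), hi =>
    have h := key i (fun k hk => hz k (by omega))
    rw [hz i (by omega)] at h
    linarith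

/-- Newton-type Krylov sequence. -/
def bandSeq (x : ℤ) (s c : ℕ → ℤ) (z : ℕ → ℤ) : ℕ → ℕ → ℤ
  | 0 => z
  | (j + 1) => fun k => bandOp x s c (bandSeq x s c z j) k - altDiag x j * bandSeq x s c z j k

lemma bandSeq_filt (x : ℤ) (s c : ℕ → ℤ) (z : ℕ → ℤ) (j : ℕ) :
    ∀ k < j, bandSeq x s c z j k = 0 := by
  induction j with
  | zero => simp
  | succ j ih =>
    intro k hk
    simp only [bandSeq]
    rw [bandOp_filt x s c _ j ih k hk, sub_self]

lemma bandSeq_diag (x : ℤ) (s c : ℕ → ℤ)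
    (hq : ∀ i, s i * s (i + 1) + c i * (2 * altDiag x i - x) = 1) (z : ℕ → ℤ) (j : ℕ) :
    bandSeq x s c z (j + 2) (j + 2) = bandSeq x s c z j j := by
  have h := (bandOp_quad x s c hq _ j (bandSeq_filt x s c z j)).2
  rw [← h]
  simp only [bandSeq]
  rw [bandOp_sub_smul, altDiag_add]
  linear_combination (-bandSeq x s c z j (j + 2)) * altDiag_sq x j

lemma bandSeq_diag_cases (x : ℤ) (s c : ℕ → ℤ)
    (hq : ∀ i, s i * s (i + 1) + c i * (2 * altDiag x i - x) = 1) (z : ℕ → ℤ) (j : ℕ) :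
    bandSeq x s c z j j = z 0 ∨ bandSeq x s c z j j = x * z 1 + s 0 * z 0 := by
  induction j using Nat.strong_induction_on with
  | _ j ih =>
    match j, ih with
    | 0, _ => left; rfl
    | 1, _ => right; simp [bandSeq, bandOp, altDiag]
    | (j + 2), ih => rw [bandSeq_diag x s c hq]; exact ih j (by omega)


lemma exists_split (n : ℕ) (V : Type) [AddCommGroup V] [Module.Free ℤ V] [Module.Finite ℤ V]
    (hn : Module.finrank ℤ V = n + 1) (r : V →ₗ[ℤ] ℤ) :
    ∃ (ρ : V →ₗ[ℤ] ℤ) (w : V) (g : ℤ), ρ w = 1 ∧ r = g • ρ := by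
  by_cases hr : r = 0
  · let b := Module.finBasisOfFinrankEq ℤ V hn
    exact ⟨b.coord 0, b 0, 0, by simp, by simp [hr]⟩
  · obtain ⟨g, hg⟩ := (IsPrincipalIdealRing.principal (LinearMap.range r)).principal
    have hg0 : g ≠ 0 := by
      rintro rfl
      apply hr
      rw [← LinearMap.range_eq_bot, hg]; simp
    have hmem : ∀ v, ∃ a : ℤ, a * g = r v := by
      intro v
      have : r v ∈ LinearMap.range r := ⟨v, rfl⟩
      rw [hg, Submodule.mem_span_singleton] at this
      exact this
    choose f hf using hmem
    let ρ : V →ₗ[ℤ] ℤ :=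
      { toFun := f
        map_add' := fun a b => by
          apply mul_right_cancel₀ hg0
          rw [add_mul, hf, hf, hf, map_add]
        map_smul' := fun a b => by
          apply mul_right_cancel₀ hg0
          simp only [RingHom.id_apply, smul_eq_mul]
          rw [mul_assoc, hf, hf, map_smul, smul_eq_mul] }
    have : g ∈ LinearMap.range r := by rw [hg]; exact Submodule.mem_span_singleton_self g
    obtain ⟨w, hw⟩ := this
    refine ⟨ρ, w, g, ?_, ?_⟩
    · apply mul_right_cancel₀ hg0
      show f w * g = 1 * g
      rw [hf, hw, one_mul]
    · ext v
      show r v = g * f v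
      rw [mul_comm, hf]

lemma exists_hessenberg (n : ℕ) : ∀ (V : Type) [AddCommGroup V] [Module.Free ℤ V]
    [Module.Finite ℤ V] (_ : Module.finrank ℤ V = n) (φ : V →ₗ[ℤ] V) (r : V →ₗ[ℤ] ℤ),
    ∃ b : Module.Basis (Fin n) ℤ V, (∀ i : Fin n, 0 < (i : ℕ) → r (b i) = 0) ∧
      ∀ i j : Fin n, (i : ℕ) + 2 ≤ j → b.repr (φ (b j)) i = 0 := by
  induction n with
  | zero =>
    intro V _ _ _ hn φ r
    exact ⟨Module.finBasisOfFinrankEq ℤ V hn, fun i => i.elim0, fun i => i.elim0⟩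
  | succ n ih =>
    intro V _ _ _ hn φ r
    obtain ⟨ρ, w, g, hw, hr⟩ := exists_split n V hn r
    let N := LinearMap.ker ρ
    let π : V →ₗ[ℤ] N := LinearMap.codRestrict N (LinearMap.id - ρ.smulRight w) (by
      intro v
      simp [N, hw])
    have hπ : ∀ v, (π v : V) = v - ρ v • w := fun v => rfl
    have hNrank : Module.finrank ℤ N = n := by
      have h1 := Submodule.finrank_quotient_add_finrank (LinearMap.ker ρ)
      have h2 : Function.Surjective ρ := by
        intro a
        exact ⟨a • w, by simp [hw]⟩
      rw [(ρ.quotKerEquivOfSurjective h2).finrank_eq, Module.finrank_self, hn] at h1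
      show Module.finrank ℤ (LinearMap.ker ρ) = n
      omega
    obtain ⟨b', hb1, hb2⟩ := ih N hNrank (π ∘ₗ φ ∘ₗ N.subtype) (ρ ∘ₗ φ ∘ₗ N.subtype)
    let b : Module.Basis (Fin (n + 1)) ℤ V := Module.Basis.mkFinCons w b'
      (by
        intro c x hx hc
        have := congrArg ρ hc
        have hx' : ρ x = 0 := hx
        simpa [hw, hx'] using this)
      (by
        intro z
        refine ⟨-ρ z, ?_⟩
        simp [N, hw])
    have hb0 : b 0 = w := by simp [b]
    have hbs : ∀ i : Fin n, b i.succ = (b' i : V) := by intro i; simp [b]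
    have hρb : ∀ i : Fin n, ρ (b i.succ) = 0 := by
      intro i; rw [hbs]; exact (b' i).2
    have hexp : ∀ v, v = ∑ i : Fin (n + 1),
        (Fin.cons (ρ v) (fun i => b'.repr (π v) i) : Fin (n + 1) → ℤ) i • b i := by
      intro v
      rw [Fin.sum_univ_succ]
      simp only [Fin.cons_zero, Fin.cons_succ, hb0, hbs]
      have h1 := congrArg (Subtype.val) (b'.sum_repr (π v))
      rw [hπ] at h1
      simp only [Submodule.coe_sum, Submodule.coe_smul] at h1
      rw [h1]; abel
    have hrepr : ∀ v i, b.repr v i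
        = (Fin.cons (ρ v) (fun i => b'.repr (π v) i) : Fin (n + 1) → ℤ) i := by
      intro v i
      conv_lhs => rw [hexp v]
      rw [b.repr_sum_self]
    refine ⟨b, ?_, ?_⟩
    · intro i hi
      refine Fin.cases (fun h => by simp at h) (fun i _ => ?_) i hi
      rw [hr, LinearMap.smul_apply, hρb, smul_zero]
    · intro i j hij
      rw [hrepr]
      have hj0 : j ≠ 0 := by rintro rfl; simp at hij
      obtain ⟨j, rfl⟩ := Fin.exists_succ_eq.mpr hj0
      rw [hbs]
      refine Fin.cases (fun h => ?_) (fun i h => ?_) i hij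
      · exact hb1 j (by simp at h; omega)
      · exact hb2 i j (by simp at h; omega)


open Matrix in
lemma hessenberg_case (n : ℕ) (A : Matrix (Fin (n + 1)) (Fin (n + 1)) ℤ)
    (hA : ∀ i j : Fin (n + 1), (i : ℕ) + 2 ≤ j → A i j = 0) (h0 : A.trace = 0) :
    ∃ X Y : Matrix (Fin (n + 1)) (Fin (n + 1)) ℤ, A = X * Y - Y * X := by
  let a : ℕ → ℕ → ℤ := fun i j =>
    if h : i < n + 1 ∧ j < n + 1 then A ⟨i, h.1⟩ ⟨j, h.2⟩ else 0
  have ha : ∀ i j : Fin (n + 1), A i j = a i j := by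
    intro i j; simp only [a]; rw [dif_pos ⟨i.2, j.2⟩]
  obtain ⟨x, s, hsum, hs, hcop⟩ := number_lemma (n + 1) (fun i => a i (i + 1))
    (∑ i ∈ Finset.range (n + 1), if Even i then 0 else a i i)
  have hc : ∀ i, ∃ c : ℤ, s i * s (i + 1) + c * (2 * altDiag x i - x) = 1 := by
    intro i
    obtain ⟨k, hk⟩ := hs i
    unfold altDiag
    split_ifs
    · exact ⟨k, by linear_combination hk⟩
    · exact ⟨-k, by linear_combination hk⟩
  choose c hq using hc
  let X : Matrix (Fin (n + 1)) (Fin (n + 1)) ℤ := Matrix.of fun i j => bandEntry x s c i j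
  -- action on truncated sequences
  have hXz : ∀ z : ℕ → ℤ, X *ᵥ (fun i : Fin (n + 1) => z i) =
      fun i : Fin (n + 1) => bandOp x s c z i := by
    intro z
    ext i
    rw [← sum_bandEntry x s c z (n + 1) i i.2, Finset.sum_range]
    rfl
  have hcolE : ∀ (B : Matrix (Fin (n + 1)) (Fin (n + 1)) ℤ) (i j : Fin (n + 1)),
      B i j = (B *ᵥ (fun i : Fin (n + 1) => (fun k : ℕ => if k = (j : ℕ) then (1 : ℤ) else 0) i)) i := by
    intro B i j
    simp [Matrix.mulVec, dotProduct, ← Fin.ext_iff]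
  -- X^2 - x X is two steps below the diagonal
  have hQ : ∀ i j : Fin (n + 1), (i : ℕ) < j + 2 → (X * X - x • X) i j = 0 := by
    intro i j hij
    refine (hcolE _ i j).trans ?_
    rw [Matrix.sub_mulVec, ← Matrix.mulVec_mulVec, Matrix.smul_mulVec,
      hXz (fun k : ℕ => if k = (j : ℕ) then (1 : ℤ) else 0), hXz (bandOp x s c _)]
    have h := (bandOp_quad x s c hq (fun k : ℕ => if k = (j : ℕ) then (1 : ℤ) else 0) j
      (fun k hk => by simp; omega)).1 i hij
    simp [h]
  have hXl : ∀ i j : Fin (n + 1), i < j → X i j = 0 := by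
    intro i j hij
    have : (i : ℕ) < j := hij
    simp only [X, Matrix.of_apply, bandEntry]
    rw [if_neg (by omega), if_neg (by omega), if_neg (by omega)]
  have hpow : ∀ r, ∀ i j : Fin (n + 1), (i : ℕ) < j + 2 → (X ^ (r + 1) - x ^ r • X) i j = 0 := by
    intro r
    induction r with
    | zero => intro i j _; simp
    | succ r ih =>
      intro i j hij
      have e : X ^ (r + 1 + 1) - x ^ (r + 1) • X
          = X * (X ^ (r + 1) - x ^ r • X) + x ^ r • (X * X - x • X) := by
        rw [Matrix.mul_sub, pow_succ' X (r + 1), Matrix.mul_smul, smul_sub, smul_smul, pow_succ x r]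
        abel
      rw [e, Matrix.add_apply, Matrix.smul_apply, hQ i j hij, smul_zero, add_zero, Matrix.mul_apply]
      refine Finset.sum_eq_zero fun k _ => ?_
      by_cases hk : i < k
      · rw [hXl i k hk, zero_mul]
      · have : (k : ℕ) ≤ i := not_lt.mp hk
        rw [ih k j (by omega), mul_zero]
  have htr2 : ∀ Z : Matrix (Fin (n + 1)) (Fin (n + 1)) ℤ,
      (∀ i j : Fin (n + 1), (i : ℕ) < j + 2 → Z i j = 0) → (Z * A).trace = 0 := by
    intro Z hZ
    refine Finset.sum_eq_zero fun i _ => ?_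
    rw [Matrix.diag_apply, Matrix.mul_apply]
    refine Finset.sum_eq_zero fun j _ => ?_
    by_cases hij : (i : ℕ) < j + 2
    · rw [hZ i j hij, zero_mul]
    · rw [hA j i (by omega), mul_zero]
  have htrX : (X * A).trace = 0 := by
    rw [Matrix.trace_mul_comm]
    have h1 : ∀ i ∈ Finset.range (n + 1), ∑ j ∈ Finset.range (n + 1), a i j * bandEntry x s c j i
        = x * (if Even i then 0 else a i i) + s i * a i (i + 1) := by
      intro i hi
      have h2 : ∀ j ∈ Finset.range (n + 1), a i j * bandEntry x s c j i
          = (if j = i then a i i * altDiag x i else 0)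
            + (if j = i + 1 then a i (i + 1) * s i else 0) := by
        intro j hj
        unfold bandEntry
        by_cases e0 : j = i
        · subst e0; simp
        by_cases e1 : j = i + 1
        · subst e1; simp
        by_cases e2 : j = i + 2
        · subst e2
          have h3 : a i (i + 2) = 0 := by
            simp only [a]
            split_ifs with h
            · exact hA _ _ (by simp)
            · rfl
          simp [h3]
        simp [e0, e1, e2]
      rw [Finset.sum_congr rfl h2, Finset.sum_add_distrib, Finset.sum_ite_eq', Finset.sum_ite_eq',
        if_pos hi]
      have h4 : (if i + 1 ∈ Finset.range (n + 1) then a i (i + 1) * s i else 0)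
          = s i * a i (i + 1) := by
        split_ifs with h
        · ring
        · have : a i (i + 1) = 0 := by
            simp only [a]
            rw [dif_neg]
            intro h'
            exact h (Finset.mem_range.mpr h'.2)
          simp [this]
      rw [h4]
      unfold altDiag
      split_ifs <;> ring
    have h5 : (A * X).trace = ∑ i ∈ Finset.range (n + 1), ∑ j ∈ Finset.range (n + 1),
        a i j * bandEntry x s c j i := by
      rw [Finset.sum_range]
      refine Finset.sum_congr rfl fun i _ => ?_
      rw [Finset.sum_range, Matrix.diag_apply, Matrix.mul_apply]
      refine Finset.sum_congr rfl fun j _ => ?_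
      rw [ha i j]
      rfl
    rw [h5, Finset.sum_congr rfl h1, Finset.sum_add_distrib, ← Finset.mul_sum]
    exact hsum
  have htr : ∀ r, (X ^ r * A).trace = 0 := by
    intro r
    cases r with
    | zero => simpa using h0
    | succ r =>
      have h1 := htr2 _ (hpow r)
      rw [Matrix.sub_mul, Matrix.trace_sub, Matrix.smul_mul, Matrix.trace_smul, htrX] at h1
      simpa using h1
  -- the two Krylov bases
  have hkry : ∀ z : ℕ → ℤ, ∃ Y : Matrix (Fin (n + 1)) (Fin (n + 1)) ℤ,
      (∏ i : Fin (n + 1), bandSeq x s c z i i) • A = X * Y - Y * X := by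
    intro z
    obtain ⟨Y, hY⟩ := krylov n X A (altDiag x) (fun j i => bandSeq x s c z j i) (by
      intro j
      rw [hXz]
      rfl) htr
    refine ⟨Y, ?_⟩
    rw [← hY, Matrix.det_of_isLowerTriangular]
    · rfl
    · intro i j hij
      exact bandSeq_filt x s c z j i hij
  obtain ⟨Y1, hY1⟩ := hkry (fun k => if k = 0 then 1 else 0)
  obtain ⟨Y2, hY2⟩ := hkry (fun k => if k = 0 then x else 1 - s 0)
  have hcp : IsCoprime
      (∏ i : Fin (n + 1), bandSeq x s c (fun k => if k = 0 then 1 else 0) i i)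
      (∏ i : Fin (n + 1), bandSeq x s c (fun k => if k = 0 then x else 1 - s 0) i i) := by
    refine IsCoprime.prod_left fun i _ => IsCoprime.prod_right fun j _ => ?_
    rcases bandSeq_diag_cases x s c hq (fun k => if k = 0 then 1 else 0) i with h1 | h1
    · rw [h1]; simpa using isCoprime_one_left
    · rcases bandSeq_diag_cases x s c hq (fun k => if k = 0 then x else 1 - s 0) j with h2 | h2
      · rw [h1, h2]; simpa using hcop
      · rw [h2]
        rw [h1]
        simp only [one_ne_zero, if_false, if_true, mul_zero, mul_one, zero_add]
        rw [show x * (1 - s 0) + s 0 * x = x by ring]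
        exact hcop
  obtain ⟨p, q, hpq⟩ := hcp
  refine ⟨X, p • Y1 + q • Y2, ?_⟩
  have h1 : A = p • ((∏ i : Fin (n + 1), bandSeq x s c (fun k => if k = 0 then 1 else 0) i i) • A)
      + q • ((∏ i : Fin (n + 1), bandSeq x s c (fun k => if k = 0 then x else 1 - s 0) i i) • A) := by
    rw [smul_smul, smul_smul, ← add_smul, hpq, one_smul]
  rw [hY1, hY2] at h1
  rw [Matrix.mul_add, Matrix.add_mul, Matrix.mul_smul, Matrix.mul_smul, Matrix.smul_mul,
    Matrix.smul_mul]
  refine h1.trans ?_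
  rw [smul_sub, smul_sub]
  abel

theorem stmt12 (n : ℕ) (M : Matrix (Fin n) (Fin n) ℤ) (h : M.trace = 0) :
    ∃ X Y : Matrix (Fin n) (Fin n) ℤ, M = X * Y - Y * X := by
  cases n with
  | zero => exact ⟨0, 0, Subsingleton.elim _ _⟩
  | succ n =>
    obtain ⟨b, -, hb⟩ := exists_hessenberg (n + 1) (Fin (n + 1) → ℤ) (by simp)
      (Matrix.toLinAlgEquiv' M) 0
    let e := (Matrix.toLinAlgEquiv' (R := ℤ) (n := Fin (n + 1))).trans
      (LinearMap.toMatrixAlgEquiv b)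
    obtain ⟨X, Y, hXY⟩ := hessenberg_case n (e M)
      (by
        intro i j hij
        have := hb i j hij
        rw [← this]
        exact LinearMap.toMatrixAlgEquiv_apply b _ i j)
      (by
        have h1 : (e M).trace = LinearMap.trace ℤ _ (Matrix.toLinAlgEquiv' M) :=
          (LinearMap.trace_eq_matrix_trace ℤ b _).symm
        have h2 : LinearMap.trace ℤ _ (Matrix.toLinAlgEquiv' M) = M.trace :=
          Matrix.trace_toLin'_eq M
        rw [h1, h2, h])
    refine ⟨e.symm X, e.symm Y, ?_⟩
    apply e.injective
    rw [map_sub, map_mul, map_mul, AlgEquiv.apply_symm_apply, AlgEquiv.apply_symm_apply]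
    exact hXY
end

section
/- Let P₀, S₀ ∈ Mₙ(ℤ) with tr(P₀) = tr(S₀), and let a₃, a₄, a₅, a₆ be integers with a₃t₃ + a₄t₄ = 1 and a₅t₅ + a₆t₆ = 1 for some integers t₃, t₄, t₅, t₆. Then the block-diagonal matrix diag(P₀, S₀) ∈ M₂ₙ(ℤ) can be written as a₃A₃² + a₄A₄² + a₅A₅² + a₆A₆² for some Aᵢ ∈ M₂ₙ(ℤ). -/
open Matrix

/-- companion lemma -/
lemma companion_comm (N : ℕ) (C T : Matrix (Fin (N+1)) (Fin (N+1)) ℤ)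
    (hC : ∀ i : Fin N, ∀ j, C i.castSucc j = if j = i.succ then 1 else 0)
    (hT : ∀ k : ℕ, (C ^ k * T).trace = 0) :
    ∃ Z : Matrix (Fin (N+1)) (Fin (N+1)) ℤ, C * Z - Z * C = T := by
  let z : ℕ → (Fin (N+1) → ℤ) := fun k => Nat.rec 0
    (fun k r => r ᵥ* C + (if h : k < N + 1 then T ⟨k, h⟩ else 0)) k
  let Z : Matrix (Fin (N+1)) (Fin (N+1)) ℤ := fun i => z i
  have hZ : ∀ i j, Z i j = z i j := fun _ _ => rfl
  refine ⟨Z, ?_⟩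
  set R := C * Z - Z * C - T with hR
  have hrow : ∀ i : Fin N, R i.castSucc = 0 := by
    intro i
    funext j
    have h1 : (C * Z) i.castSucc j = z (i+1) j := by
      simp [Matrix.mul_apply, hC, hZ]
    have h2 : z (i+1) = z i ᵥ* C + T i.castSucc := by
      change z i ᵥ* C + (if h : (i:ℕ) < N + 1 then T ⟨i, h⟩ else 0) = _
      rw [dif_pos (by omega)]; rfl
    have h3 : (Z * C) i.castSucc j = (z i ᵥ* C) j := by
      simp [Matrix.mul_apply, hZ, Matrix.vecMul, dotProduct]
    simp only [hR, Matrix.sub_apply, h1, h2, h3, Pi.add_apply, Pi.zero_apply]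
    ring
  have htr : ∀ k, (C ^ k * R).trace = 0 := by
    intro k
    rw [hR, Matrix.mul_sub, Matrix.trace_sub, hT, Matrix.mul_sub, Matrix.trace_sub,
      ← Matrix.mul_assoc, ← Matrix.mul_assoc, Matrix.trace_mul_comm (C ^ k * Z) C,
      ← Matrix.mul_assoc, ← pow_succ, ← pow_succ', sub_self, sub_zero]
  have hl : ∀ k, R (Fin.last N) ⬝ᵥ ((C ^ k).col (Fin.last N)) = 0 := by
    intro k
    rw [← htr k, Matrix.trace_mul_comm, Matrix.trace, Fin.sum_univ_castSucc]
    have : ∀ i : Fin N, (R * C ^ k).diag i.castSucc = 0 := by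
      intro i
      simp [Matrix.mul_apply, hrow]
    rw [Finset.sum_eq_zero (fun i _ => this i), zero_add]
    simp [Matrix.mul_apply, dotProduct]
  have hstep : ∀ k, ∀ i : Fin N, (C ^ (k+1)).col i.succ =
      (C ^ k).col i.castSucc + C (Fin.last N) i.succ • (C ^ k).col (Fin.last N) := by
    intro k i
    funext a
    simp only [Matrix.col_apply, Pi.add_apply, Pi.smul_apply, smul_eq_mul]
    rw [pow_succ, Matrix.mul_apply, Fin.sum_univ_castSucc]
    simp [hC, Fin.succ_inj, mul_comm]
  have hall : ∀ i : Fin (N+1), ∀ k, R (Fin.last N) ⬝ᵥ ((C ^ k).col i) = 0 := by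
    intro i
    induction i using Fin.reverseInduction with
    | last => exact hl
    | cast i ih =>
      intro k
      have := ih (k+1)
      rw [hstep, dotProduct_add, dotProduct_smul, hl] at this
      simpa using this
  have hlast : R (Fin.last N) = 0 := by
    funext i
    have := hall i 0
    simpa [dotProduct, Matrix.one_apply] using this
  have : R = 0 := by
    funext i
    induction i using Fin.lastCases with
    | last => exact hlast
    | cast i => exact hrow i
  exact sub_eq_zero.mp this

lemma cyclic_comm {ι : Type*} [Fintype ι] [DecidableEq ι] (N : ℕ) (e : Fin (N+1) ≃ ι)
    (X S : Matrix ι ι ℤ) (d m : ℤ) (hN : 1 ≤ N) (hX : X ^ (N+1) = d • X) (w : ι → ℤ)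
    (W' : Matrix ι (Fin (N+1)) ℤ)
    (hW : W' * (Matrix.of fun k : Fin (N+1) => w ᵥ* X ^ (k:ℕ)) = m • (1 : Matrix ι ι ℤ))
    (hS : ∀ k : ℕ, (X ^ k * S).trace = 0) :
    ∃ Y, X * Y - Y * X = (m * m) • S := by
  rcases eq_or_ne m 0 with rfl | hm
  · exact ⟨0, by simp⟩
  set W : Matrix (Fin (N+1)) ι ℤ := Matrix.of fun k : Fin (N+1) => w ᵥ* X ^ (k:ℕ) with hWd
  have hW2 : W * W' = m • (1 : Matrix (Fin (N+1)) (Fin (N+1)) ℤ) := by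
    have h1 : ((m:ℚ)⁻¹ • W'.map (Int.cast : ℤ → ℚ)) * W.map (Int.cast : ℤ → ℚ) = 1 := by
      have := congrArg (fun M => M.map (Int.castRingHom ℚ)) hW
      simp only [Matrix.map_mul] at this
      rw [Matrix.smul_mul]
      erw [this]
      ext i j
      by_cases h : i = j <;> simp [Matrix.one_apply, h, hm, -zsmul_eq_mul, -zsmul_one]
    rw [Matrix.mul_eq_one_comm_of_equiv e.symm] at h1
    ext i j
    have h2 := congrFun (congrFun h1 i) j
    rw [Matrix.mul_smul, Matrix.smul_apply, Matrix.mul_apply] at h2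
    simp only [Matrix.map_apply, smul_eq_mul] at h2
    rw [inv_mul_eq_iff_eq_mul₀ (by exact_mod_cast hm)] at h2
    have h3 : (((W * W') i j : ℤ) : ℚ) = ((m • (1 : Matrix (Fin (N+1)) (Fin (N+1)) ℤ)) i j : ℤ) := by
      rw [Matrix.mul_apply]
      push_cast
      rw [h2]
      by_cases h : i = j <;> simp [Matrix.one_apply, h, -zsmul_eq_mul, -zsmul_one]
    exact_mod_cast h3
  let C : Matrix (Fin (N+1)) (Fin (N+1)) ℤ := fun i j =>
    if (i:ℕ) < N then (if (j:ℕ) = i + 1 then 1 else 0) else (if (j:ℕ) = 1 then d else 0)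
  have hC : ∀ i : Fin N, ∀ j, C i.castSucc j = if j = i.succ then 1 else 0 := by
    intro i j
    simp [C, Fin.ext_iff]
  have hWX : W * X = C * W := by
    ext i j
    have h1 : (W * X) i j = (w ᵥ* X ^ ((i:ℕ)+1)) j := by
      rw [pow_succ, ← Matrix.vecMul_vecMul]; rfl
    rw [h1]
    induction i using Fin.lastCases with
    | last =>
      have : (C * W) (Fin.last N) j = d * W ⟨1, by omega⟩ j := by
        rw [Matrix.mul_apply, Finset.sum_eq_single ⟨1, by omega⟩]
        · simp [C]
        · intro b _ hb
          have : (b:ℕ) ≠ 1 := fun h => hb (Fin.ext h)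
          simp [C, this]
        · simp
      rw [this]
      simp [hX, hWd, Matrix.vecMul_smul, -zsmul_eq_mul, -zsmul_one]
    | cast i =>
      simp [Matrix.mul_apply, hC, hWd]
  have hCk : ∀ k : ℕ, C ^ k * W = W * X ^ k := by
    intro k
    induction k with
    | zero => simp
    | succ k ih => rw [pow_succ, Matrix.mul_assoc, ← hWX, ← Matrix.mul_assoc, ih,
        Matrix.mul_assoc, ← pow_succ]
  obtain ⟨Z, hZ⟩ := companion_comm N C (W * S * W') hC (by
    intro k
    rw [← Matrix.mul_assoc, ← Matrix.mul_assoc, hCk, Matrix.trace_mul_comm, ← Matrix.mul_assoc,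
      ← Matrix.mul_assoc, hW]
    simp [hS, -zsmul_eq_mul, -zsmul_one])
  have hXW : X * W' = W' * C := by
    have h1 : W' * (W * X) * W' = W' * (C * W) * W' := by rw [hWX]
    rw [← Matrix.mul_assoc, hW, ← Matrix.mul_assoc, Matrix.mul_assoc (W' * C), hW2] at h1
    simp only [Matrix.smul_mul, Matrix.one_mul, Matrix.mul_smul, Matrix.mul_one] at h1
    exact smul_right_injective _ hm h1
  refine ⟨W' * Z * W, ?_⟩
  have : X * (W' * Z * W) - W' * Z * W * X = W' * (C * Z - Z * C) * W := by
    rw [Matrix.mul_assoc _ W X, hWX, ← Matrix.mul_assoc, ← Matrix.mul_assoc, hXW]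
    simp only [Matrix.mul_sub, Matrix.sub_mul, Matrix.mul_assoc]
  rw [this, hZ]
  have : W' * (W * S * W') * W = (W' * W) * S * (W' * W) := by simp only [Matrix.mul_assoc]
  rw [this, hW]
  simp [mul_smul, -zsmul_eq_mul, -zsmul_one]

lemma comm_two (S : Matrix (Fin 2) (Fin 2) ℤ) (h : S.trace = 0) :
    ∃ X Y : Matrix (Fin 2) (Fin 2) ℤ, X * Y - Y * X = S := by
  have key : ∃ g c b α β : ℤ, S 1 0 = g * c ∧ S 0 1 = g * b ∧ α * c + β * b = 1 := by
    by_cases h0 : S 1 0 = 0 ∧ S 0 1 = 0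
    · exact ⟨0, 1, 0, 1, 0, by simp [h0.1], by simp [h0.2], by simp⟩
    · have hg : Int.gcd (S 1 0) (S 0 1) ≠ 0 := by
        rw [Ne, Int.gcd_eq_zero_iff]; exact h0
      have hg' : ((Int.gcd (S 1 0) (S 0 1) : ℕ) : ℤ) ≠ 0 := by exact_mod_cast hg
      obtain ⟨c, hc⟩ := Int.gcd_dvd_left (S 1 0) (S 0 1)
      obtain ⟨b, hb⟩ := Int.gcd_dvd_right (S 1 0) (S 0 1)
      have hB := Int.gcd_eq_gcd_ab (S 1 0) (S 0 1)
      refine ⟨_, c, b, Int.gcdA (S 1 0) (S 0 1), Int.gcdB (S 1 0) (S 0 1), hc, hb, ?_⟩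
      apply mul_left_cancel₀ hg'
      generalize Int.gcdA (S 1 0) (S 0 1) = A at *
      generalize Int.gcdB (S 1 0) (S 0 1) = B at *
      generalize ((Int.gcd (S 1 0) (S 0 1) : ℕ) : ℤ) = G at *
      rw [hc, hb] at hB
      linear_combination -hB
  obtain ⟨g, c, b, α, β, hc, hb, hab⟩ := key
  have htr : S 0 0 + S 1 1 = 0 := by simpa [Matrix.trace, Fin.sum_univ_two] using h
  refine ⟨!![0, b; -c, 0], !![-g, S 0 0 * α; S 0 0 * β, 0], ?_⟩
  ext i j
  fin_cases i <;> fin_cases j <;> simp [Matrix.mul_apply, Fin.sum_univ_two]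
  · linear_combination S 0 0 * hab
  · linear_combination -hb
  · linear_combination -hc
  · linear_combination - S 0 0 * hab - htr

/-- conjugacy over ℤ -/
def Cj {ι : Type*} [Fintype ι] [DecidableEq ι] (S T : Matrix ι ι ℤ) : Prop :=
  ∃ U V : Matrix ι ι ℤ, U * V = 1 ∧ V * U = 1 ∧ T = U * S * V

section
variable {ι : Type*} [Fintype ι] [DecidableEq ι]

lemma Cj.refl (S : Matrix ι ι ℤ) : Cj S S := ⟨1, 1, by simp, by simp, by simp⟩

lemma Cj.trans {S T R : Matrix ι ι ℤ} (h : Cj S T) (h' : Cj T R) : Cj S R := by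
  obtain ⟨U, V, h1, h2, rfl⟩ := h
  obtain ⟨U', V', h1', h2', rfl⟩ := h'
  refine ⟨U' * U, V * V', ?_, ?_, ?_⟩
  · calc U' * U * (V * V') = U' * (U * V) * V' := by simp only [Matrix.mul_assoc]
      _ = 1 := by rw [h1, Matrix.mul_one, h1']
  · calc V * V' * (U' * U) = V * (V' * U') * U := by simp only [Matrix.mul_assoc]
      _ = 1 := by rw [h2', Matrix.mul_one, h2]
  · simp only [Matrix.mul_assoc]

lemma Cj.symm {S T : Matrix ι ι ℤ} (h : Cj S T) : Cj T S := by
  obtain ⟨U, V, h1, h2, rfl⟩ := h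
  refine ⟨V, U, h2, h1, ?_⟩
  calc S = (V * U) * S * (V * U) := by rw [h2]; simp
    _ = _ := by simp only [Matrix.mul_assoc]

lemma Cj.transpose {S T : Matrix ι ι ℤ} (h : Cj S T) : Cj Sᵀ Tᵀ := by
  obtain ⟨U, V, h1, h2, rfl⟩ := h
  refine ⟨Vᵀ, Uᵀ, ?_, ?_, ?_⟩
  · rw [← Matrix.transpose_mul, h1, Matrix.transpose_one]
  · rw [← Matrix.transpose_mul, h2, Matrix.transpose_one]
  · simp only [Matrix.transpose_mul, Matrix.mul_assoc]

lemma Cj.comm {S T : Matrix ι ι ℤ} (h : Cj S T) (hT : ∃ X Y, X * Y - Y * X = T) :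
    ∃ X Y, X * Y - Y * X = S := by
  obtain ⟨U, V, h1, h2, hS⟩ := h.symm
  obtain ⟨X, Y, rfl⟩ := hT
  refine ⟨U * X * V, U * Y * V, ?_⟩
  rw [hS]
  calc U * X * V * (U * Y * V) - U * Y * V * (U * X * V)
      = U * X * (V * U) * Y * V - U * Y * (V * U) * X * V := by simp only [Matrix.mul_assoc]
    _ = _ := by rw [h2]; simp only [Matrix.mul_sub, Matrix.sub_mul, Matrix.mul_assoc, Matrix.one_mul]

/-- row_j += ∑ q_k row_k, col_k -= q_k col_j -/
lemma Cj.row (S : Matrix ι ι ℤ) (j : ι) (q : ι → ℤ) (hq : q j = 0) :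
    ∃ T, Cj S T ∧ ∀ a b, T a b = S a b + (if a = j then ∑ k, q k * S k b else 0) - S a j * q b
      - (if a = j then (∑ k, q k * S k j) * q b else 0) := by
  let Q : Matrix ι ι ℤ := Matrix.of fun a b => if a = j then q b else 0
  have hQ : Q * Q = 0 := by
    ext a b
    simp [Q, Matrix.mul_apply, hq]
  refine ⟨(1 + Q) * S * (1 - Q), ⟨1 + Q, 1 - Q, ?_, ?_, rfl⟩, ?_⟩
  · rw [Matrix.add_mul, Matrix.mul_sub, Matrix.mul_sub, hQ]; simp
  · rw [Matrix.sub_mul, Matrix.mul_add, Matrix.mul_add, hQ]; simp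
  · intro a b
    have h1 : ∀ M : Matrix ι ι ℤ, ∀ a b, (Q * M) a b = if a = j then ∑ k, q k * M k b else 0 := by
      intro M a b
      by_cases h : a = j <;> simp [Q, Matrix.mul_apply, h]
    have h2 : ∀ M : Matrix ι ι ℤ, ∀ a b, (M * Q) a b = M a j * q b := by
      intro M a b
      simp [Q, Matrix.mul_apply]
    simp only [Matrix.add_mul, Matrix.mul_sub, Matrix.one_mul, Matrix.mul_one, Matrix.sub_apply,
      Matrix.add_apply, h1, h2]
    by_cases h : a = j <;> simp [h]
    ring

/-- row_i += t row_j, col_j -= t col_i -/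
lemma Cj.op (S : Matrix ι ι ℤ) (i j : ι) (hij : i ≠ j) (t : ℤ) :
    ∃ T, Cj S T ∧ ∀ a b, T a b = S a b + (if a = i then t * S j b else 0)
      - (if b = j then t * S a i else 0)
      - (if a = i ∧ b = j then t * t * S j i else 0) := by
  obtain ⟨T, h, hT⟩ := Cj.row S i (fun k => if k = j then t else 0) (by simp [hij])
  refine ⟨T, h, ?_⟩
  intro a b
  rw [hT]
  by_cases ha : a = i <;> by_cases hb : b = j <;> simp [ha, hb] <;> ring

def MinC (S : Matrix ι ι ℤ) (g : ℕ) : Prop :=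
  ∀ T, Cj S T → ∀ i j, i ≠ j → T i j ≠ 0 → g ≤ (T i j).natAbs

lemma MinC.transpose {S : Matrix ι ι ℤ} {g : ℕ} (h : MinC S g) : MinC Sᵀ g := by
  intro T hT i j hij hne
  have := h Tᵀ (by simpa using hT.transpose) j i hij.symm hne
  simpa using this

lemma MinC.gcd {S : Matrix ι ι ℤ} {g : ℕ} (h : MinC S g) {i j k : ι} (hij : i ≠ j) (hik : i ≠ k)
    (hjk : j ≠ k) : ∀ m : ℕ, ∀ T, Cj S T → (T i j).natAbs + (T i k).natAbs = m → m ≠ 0 →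
    g ≤ Int.gcd (T i j) (T i k) := by
  intro m
  induction m using Nat.strong_induction_on generalizing j k with
  | _ m ih =>
  intro T hT hm hm0
  by_cases h1 : T i j = 0
  · have : T i k ≠ 0 := by intro h2; simp [h1, h2] at hm; omega
    simpa [h1] using h T hT i k hik this
  by_cases h2 : T i k = 0
  · simpa [h2] using h T hT i j hij h1
  wlog hle : (T i j).natAbs ≤ (T i k).natAbs generalizing j k
  · rw [Int.gcd_comm]
    exact this hik hij hjk.symm (by omega) h2 h1 (by omega)
  obtain ⟨T', hT', hT'a⟩ := Cj.op T j k hjk (T i k / T i j)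
  have e1 : T' i j = T i j := by rw [hT'a]; simp [hij, hjk]
  have e2 : T' i k = T i k % T i j := by
    rw [hT'a]; simp [hij]; rw [Int.emod_def]; ring
  have hlt : (T i k % T i j).natAbs < (T i j).natAbs := by
    have := Int.emod_lt_abs (T i k) h1
    have := Int.emod_nonneg (T i k) h1
    rw [Int.abs_eq_natAbs] at *
    omega
  have := ih ((T' i j).natAbs + (T' i k).natAbs) (by rw [e1, e2]; omega) hij hik hjk T'
    (hT.trans hT') rfl (by rw [e1]; omega)
  rw [e1, e2] at this
  rwa [Int.gcd_comm, Int.gcd_emod, Int.gcd_comm] at this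

lemma MinC.dvd {S : Matrix ι ι ℤ} {γ : ℤ} (h : MinC S γ.natAbs) (hγ : γ ≠ 0) {i j k : ι}
    (hij : i ≠ j) (hik : i ≠ k) (hjk : j ≠ k) {T} (hT : Cj S T) (hg : T i j = γ) : γ ∣ T i k := by
  have := h.gcd hij hik hjk _ T hT rfl (by rw [hg]; omega)
  rw [hg] at this
  have h2 : Int.gcd γ (T i k) ∣ γ.natAbs := by
    rw [← Int.natCast_dvd]; exact Int.gcd_dvd_left _ _
  have h3 := Nat.le_of_dvd (by omega) h2
  have h4 : Int.gcd γ (T i k) = γ.natAbs := le_antisymm h3 this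
  have h5 : ((Int.gcd γ (T i k) : ℕ) : ℤ) ∣ T i k := Int.gcd_dvd_right _ _
  rw [h4] at h5
  exact Int.natAbs_dvd.mp h5

lemma MinC.dvd' {S : Matrix ι ι ℤ} {γ : ℤ} (h : MinC S γ.natAbs) (hγ : γ ≠ 0) {i j k : ι}
    (hij : i ≠ j) (hik : i ≠ k) (hjk : j ≠ k) {T} (hT : Cj S T) (hg : T i j = γ) : γ ∣ T k j :=
  h.transpose.dvd hγ hij.symm hjk hik hT.transpose hg

/-- if `T i j = p γ` with γ minimal, all other entries of the row are divisible by p -/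
lemma MinC.dvdp {S : Matrix ι ι ℤ} {γ p : ℤ} (h : MinC S γ.natAbs) (hγ : γ ≠ 0) (hp : Prime p)
    (hpγ : p ∣ γ) {i j k : ι}
    (hij : i ≠ j) (hik : i ≠ k) (hjk : j ≠ k) {T} (hT : Cj S T) (hg : T i j = p * γ) :
    p ∣ T i k := by
  by_contra hc
  have hpg : p * γ ≠ 0 := mul_ne_zero hp.ne_zero hγ
  have := h.gcd hij hik hjk _ T hT rfl (by rw [hg]; omega)
  rw [hg] at this
  have h1 : ((Int.gcd (p * γ) (T i k) : ℕ) : ℤ) ∣ p * γ := Int.gcd_dvd_left _ _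
  have h2 : ((Int.gcd (p * γ) (T i k) : ℕ) : ℤ) ∣ T i k := Int.gcd_dvd_right _ _
  have h3 : ((Int.gcd (p * γ) (T i k) : ℕ) : ℤ) ∣ γ := by
    refine IsCoprime.dvd_of_dvd_mul_left ?_ h1
    refine IsCoprime.symm ?_
    rw [Prime.coprime_iff_not_dvd hp]
    exact fun h4 => hc (h4.trans h2)
  have h4 := Nat.le_of_dvd (by omega) (Int.natCast_dvd.mp h3)
  have h5 : Int.gcd (p * γ) (T i k) = γ.natAbs := le_antisymm h4 this
  rw [h5] at h2
  exact hc (hpγ.trans (Int.natAbs_dvd.mp h2))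

lemma MinC.cleared {S : Matrix ι ι ℤ} {γ p : ℤ} (h : MinC S γ.natAbs) (hγ : γ ≠ 0) (hp : Prime p)
    (hpγ : p ∣ γ) {i j k : ι}
    (hij : i ≠ j) (hik : i ≠ k) (hjk : j ≠ k) {T} (hT : Cj S T) (hg : T i j = γ)
    (h1 : T i k = 0) (h2 : T k j = 0) :
    p ∣ T k i ∧ p ∣ T k k - T i i ∧ ∀ l, l ≠ i → l ≠ j → l ≠ k → p ∣ T k l := by
  obtain ⟨T', hT', hT'a⟩ := Cj.op T k i hik.symm p
  have e1 : T' k j = p * γ := by rw [hT'a]; simp [hij.symm, h2, hg]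
  have e2 : T' k i = T k i + p * T i i - p * T k k := by rw [hT'a]; simp [h1]
  have A : p ∣ T k i := by
    have := h.dvdp hγ hp hpγ hjk.symm hik.symm hij.symm (hT.trans hT') e1
    rw [e2] at this
    have h3 : T k i = (T k i + p * T i i - p * T k k) + p * (T k k - T i i) := by ring
    rw [h3]
    exact dvd_add this (dvd_mul_right _ _)
  refine ⟨A, ?_, ?_⟩
  · obtain ⟨T2, hT2, hT2a⟩ := Cj.op T i k hik 1
    have f1 : T2 i j = γ := by rw [hT2a]; simp [hjk, h2, hg]
    have f2 : T2 i k = T k k - T i i - T k i := by rw [hT2a]; simp [h1]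
    have := hpγ.trans (h.dvd hγ hij hik hjk (hT.trans hT2) f1)
    rw [f2] at this
    have := dvd_add this A
    simpa using this
  · intro l hli hlj hlk
    have e3 : T' k l = T k l + p * T i l := by rw [hT'a]; simp [hli]
    have := h.dvdp hγ hp hpγ hjk.symm hlk.symm hlj.symm (hT.trans hT') e1
    rw [e3] at this
    exact (dvd_add_left (dvd_mul_right _ _)).mp this

lemma MinC.half {S : Matrix ι ι ℤ} {γ p : ℤ} (h : MinC S γ.natAbs) (hγ : γ ≠ 0) (hp : Prime p)
    (hpγ : p ∣ γ) {i j k : ι}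
    (hij : i ≠ j) (hik : i ≠ k) (hjk : j ≠ k) {T} (hT : Cj S T) (hg : T i j = γ) :
    p ∣ T k i ∧ p ∣ T k k - T i i ∧ ∀ l, l ≠ i → l ≠ j → l ≠ k → p ∣ T k l := by
  obtain ⟨q, hq⟩ := h.dvd hγ hij hik hjk hT hg
  have hkj := h.dvd' hγ hij hik hjk hT hg
  obtain ⟨T1, hT1, a1⟩ := Cj.op T j k hjk q
  have b1 : T1 i j = γ := by rw [a1]; simp [hij, hjk, hg]
  have b2 : T1 i k = 0 := by rw [a1]; simp [hij, hg, hq]; ring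
  obtain ⟨r, hr⟩ := h.dvd' hγ hij hik hjk (hT.trans hT1) b1
  obtain ⟨T2, hT2, a2⟩ := Cj.op T1 k i hik.symm (-r)
  have c1 : T2 i j = γ := by rw [a2]; simp [hik, hij.symm, b1]
  have c2 : T2 i k = 0 := by rw [a2]; simp [hik, hik.symm, b2]
  have c3 : T2 k j = 0 := by rw [a2]; simp [hij.symm, hr, b1]; ring
  obtain ⟨d1, d2, d3⟩ := h.cleared hγ hp hpγ hij hik hjk ((hT.trans hT1).trans hT2) c1 c2 c3
  have e1 : T2 k i = T k i - r * T1 i i + r * T1 k k := by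
    rw [a2]; simp [b2, a1 k i, hjk.symm, hik]; ring
  have e2 : T2 k k - T2 i i = T1 k k - T1 i i := by
    rw [a2, a2]; simp [b2, hik, hik.symm]
  have e3 : T1 k k - T1 i i = T k k - T i i - q * T k j := by
    rw [a1, a1]; simp [hij, hik, hjk.symm]; ring
  have D : p ∣ T k k - T i i := by
    rw [e2, e3] at d2
    exact (dvd_sub_left ((hpγ.trans hkj).mul_left _)).mp d2
  refine ⟨?_, D, ?_⟩
  · have : T k i = T2 k i - r * (T2 k k - T2 i i) := by rw [e1, e2]; ring
    rw [this]
    exact dvd_sub d1 (d2.mul_left _)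
  · intro l hli hlj hlk
    have f : T2 k l = T k l - r * T i l := by
      rw [a2]; simp [hli, a1, hjk.symm, hlk, hij]; ring
    have := d3 l hli hlj hlk
    rw [f] at this
    exact (dvd_sub_left ((hpγ.trans (h.dvd hγ hij hli.symm hlj.symm hT hg)).mul_left _)).mp this

def ScalarMod (p : ℤ) (T : Matrix ι ι ℤ) : Prop :=
  (∀ a b, a ≠ b → p ∣ T a b) ∧ ∀ a b, p ∣ T a a - T b b

lemma MinC.scalar {S : Matrix ι ι ℤ} {γ p : ℤ} (h : MinC S γ.natAbs) (hγ : γ ≠ 0) (hp : Prime p)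
    (hpγ : p ∣ γ) {i j k : ι}
    (hij : i ≠ j) (hik : i ≠ k) (hjk : j ≠ k) {T} (hT : Cj S T) (hg : T i j = γ) :
    ScalarMod p T := by
  have H1 : ∀ k, i ≠ k → j ≠ k → p ∣ T k i := fun k h1 h2 =>
    (h.half hγ hp hpγ hij h1 h2 hT hg).1
  have H2 : ∀ k, i ≠ k → j ≠ k → p ∣ T k k - T i i := fun k h1 h2 =>
    (h.half hγ hp hpγ hij h1 h2 hT hg).2.1
  have H3 : ∀ k, i ≠ k → j ≠ k → ∀ l, l ≠ i → l ≠ j → l ≠ k → p ∣ T k l := fun k h1 h2 =>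
    (h.half hγ hp hpγ hij h1 h2 hT hg).2.2
  have H1' : ∀ k, i ≠ k → j ≠ k → p ∣ T j k := fun k h1 h2 =>
    (h.transpose.half hγ hp hpγ hij.symm h2 h1 hT.transpose hg).1
  have H2' : ∀ k, i ≠ k → j ≠ k → p ∣ T k k - T j j := fun k h1 h2 =>
    (h.transpose.half hγ hp hpγ hij.symm h2 h1 hT.transpose hg).2.1
  have H4 : ∀ k, i ≠ k → j ≠ k → p ∣ T i k := fun k h1 h2 =>
    hpγ.trans (h.dvd hγ hij h1 h2 hT hg)
  have H5 : ∀ k, i ≠ k → j ≠ k → p ∣ T k j := fun k h1 h2 =>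
    hpγ.trans (h.dvd' hγ hij h1 h2 hT hg)
  have H6 : p ∣ T j i := by
    obtain ⟨q, hq⟩ := h.dvd hγ hij hik hjk hT hg
    obtain ⟨T1, hT1, a1⟩ := Cj.op T j k hjk q
    have b1 : T1 i j = γ := by rw [a1]; simp [hij, hjk, hg]
    have b2 : T1 i k = 0 := by rw [a1]; simp [hij, hg, hq]; ring
    have b3 : T1 j i = T j i + q * T k i := by rw [a1]; simp [hik]
    have b4 : T1 k i = T k i := by rw [a1]; simp [hik, hjk.symm]
    obtain ⟨T2, hT2, a2⟩ := Cj.op T1 k j hjk.symm 1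
    have c1 : T2 i j = γ := by rw [a2]; simp [hik, b1, b2]
    have c2 : T2 k i = T k i + (T j i + q * T k i) := by rw [a2]; simp [hij, b3, b4]
    have := (h.half hγ hp hpγ hij hik hjk ((hT.trans hT1).trans hT2) c1).1
    rw [c2] at this
    have h1 := H1 k hik hjk
    exact (dvd_add_left (h1.mul_left _)).mp ((dvd_add_right h1).mp this)
  have D : ∀ a, p ∣ T a a - T i i := by
    intro a
    by_cases ha : a = i
    · simp [ha]
    by_cases hb : a = j
    · subst hb
      have := dvd_sub (H2 k hik hjk) (H2' k hik hjk)
      simpa using this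
    · exact H2 a (Ne.symm ha) (Ne.symm hb)
  refine ⟨?_, ?_⟩
  · intro a b hab
    by_cases a1 : a = i
    · subst a1
      by_cases b1 : b = j
      · subst b1; rw [hg]; exact hpγ
      · exact H4 b hab (Ne.symm b1)
    by_cases a2 : a = j
    · subst a2
      by_cases b1 : b = i
      · subst b1; exact H6
      · exact H1' b (Ne.symm b1) hab
    by_cases b1 : b = i
    · subst b1; exact H1 a (Ne.symm a1) (Ne.symm a2)
    by_cases b2 : b = j
    · subst b2; exact H5 a (Ne.symm a1) (Ne.symm a2)
    exact H3 a (Ne.symm a1) (Ne.symm a2) b b1 b2 (Ne.symm hab)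
  · intro a b
    have := dvd_sub (D a) (D b)
    simpa using this

lemma ScalarMod.conj {p : ℤ} {S T : Matrix ι ι ℤ} (h : Cj S T) (hS : ScalarMod p S) :
    ScalarMod p T := by
  by_cases hne : Nonempty ι
  swap
  · exact ⟨fun a => (hne ⟨a⟩).elim, fun a => (hne ⟨a⟩).elim⟩
  obtain ⟨o⟩ := hne
  have : ∀ a b, ∃ r, S a b = S o o * (1 : Matrix ι ι ℤ) a b + p * r := by
    intro a b
    by_cases hab : a = b
    · subst hab
      obtain ⟨r, hr⟩ := hS.2 a o
      exact ⟨r, by simp; linarith⟩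
    · obtain ⟨r, hr⟩ := hS.1 a b hab
      exact ⟨r, by simp [hab, hr]⟩
  choose R hR using this
  have hS' : S = S o o • (1 : Matrix ι ι ℤ) + p • (Matrix.of R) := by
    ext a b
    rw [hR a b]; simp [smul_eq_mul, Matrix.of_apply, -zsmul_eq_mul, -zsmul_one]
  obtain ⟨U, V, h1, h2, h3⟩ := h
  have hT : T = S o o • (1 : Matrix ι ι ℤ) + p • (U * Matrix.of R * V) := by
    rw [h3]
    generalize S o o = c at *
    rw [hS']
    simp only [Matrix.mul_add, Matrix.add_mul, Matrix.mul_smul, Matrix.smul_mul, Matrix.mul_one, h1]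
  refine ⟨?_, ?_⟩
  · intro a b hab
    rw [hT]; simp [Matrix.one_apply, hab, -zsmul_eq_mul, -zsmul_one]
  · intro a b
    rw [hT]; simp [-zsmul_eq_mul, -zsmul_one]; rw [← mul_sub]; exact dvd_mul_right _ _

lemma exists_unit_entry (S : Matrix ι ι ℤ) (h3 : ∀ i j : ι, ∃ k, i ≠ k ∧ j ≠ k)
    (hS : ∀ p : ℤ, Prime p → ¬ ScalarMod p S) :
    ∃ T, Cj S T ∧ ∃ i j, i ≠ j ∧ IsUnit (T i j) := by
  classical
  let P : ℕ → Prop := fun g => ∃ T, Cj S T ∧ ∃ i j, i ≠ j ∧ T i j ≠ 0 ∧ (T i j).natAbs = g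
  have hex : ∃ g, P g := by
    by_contra hc
    have h0 : ∀ T, Cj S T → ∀ i j, i ≠ j → T i j = 0 := by
      intro T hT i j hij
      by_contra hne
      exact hc ⟨_, T, hT, i, j, hij, hne, rfl⟩
    apply hS 2 Int.prime_two
    refine ⟨fun a b hab => by simp [h0 S (Cj.refl S) a b hab], fun a b => ?_⟩
    by_cases hab : a = b
    · simp [hab]
    obtain ⟨T, hT, a1⟩ := Cj.op S b a (Ne.symm hab) 1
    have := h0 T hT b a (Ne.symm hab)
    rw [a1] at this
    simp [h0 S (Cj.refl S) a b hab, h0 S (Cj.refl S) b a (Ne.symm hab)] at this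
    simp [this]
  obtain ⟨T, hT, i, j, hij, hne, hg⟩ := Nat.find_spec hex
  have hmin : MinC S (T i j).natAbs := by
    intro T' hT' a b hab hne'
    rw [hg]
    exact Nat.find_min' hex ⟨T', hT', a, b, hab, hne', rfl⟩
  refine ⟨T, hT, i, j, hij, ?_⟩
  by_contra hu
  obtain ⟨p, hp, hpd⟩ := WfDvdMonoid.exists_irreducible_factor hu hne
  obtain ⟨k, hik, hjk⟩ := h3 i j
  exact hS p hp.prime (ScalarMod.conj hT.symm
    (hmin.scalar hne hp.prime hpd hij hik hjk hT rfl))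

end
lemma normal_comm (M : ℕ) (S : Matrix (Unit ⊕ Fin (M+1)) (Unit ⊕ Fin (M+1)) ℤ) (d : ℤ)
    (h01 : ∀ b : Fin (M+1), S (Sum.inl ()) (Sum.inr b) = if b = 0 then d else 0)
    (hd : ∀ a b : Fin (M+1), a ≠ b → d ∣ S (Sum.inr a) (Sum.inr b))
    (hco : IsCoprime (S (Sum.inl ()) (Sum.inl ())) d) (htr : S.trace = 0) :
    ∃ X Y, X * Y - Y * X = S := by
  let X1 : Matrix (Fin (M+1)) (Fin (M+1)) ℤ := Matrix.of fun i j =>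
    if (j:ℕ) = i + 1 then 1 else if (j:ℕ) + (M+1) = i + 1 then d else 0
  have hX1 : ∀ i j, X1 i j = if (j:ℕ) = i + 1 then 1 else if (j:ℕ) + (M+1) = i + 1 then d else 0 :=
    fun _ _ => rfl
  have hpow : ∀ k, k ≤ M + 1 → ∀ i j, (X1 ^ k) i j =
      if (j:ℕ) = i + k then 1 else if (j:ℕ) + (M+1) = i + k then d else 0 := by
    intro k
    induction k with
    | zero =>
      intro _ i j
      by_cases h : i = j
      · simp [h]
      · have h1 : ¬ (j:ℕ) = i := fun h' => h (Fin.ext h'.symm)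
        have h2 : ¬ (j:ℕ) + (M+1) = i := by omega
        simp [Matrix.one_apply, h, h1, h2]
    | succ k ih =>
      intro hk i j
      rw [pow_succ', Matrix.mul_apply]
      by_cases hi : (i:ℕ) = M
      · rw [Finset.sum_eq_single 0]
        · rw [ih (by omega), hX1]
          have h1 : ¬ (j:ℕ) = i + (k+1) := by omega
          have h2 : ¬ (j:ℕ) + (M+1) = 0 + k := by omega
          have h3 : (j:ℕ) + (M+1) = i + (k+1) ↔ (j:ℕ) = k := by omega
          simp [hi, h3]
          by_cases h4 : (j:ℕ) = k
          · have : ¬ k = M + (k+1) := by omega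
            have h7 : k + (M+1) = M + (k+1) := by omega
            simp [h4, this, h7]
          · have : ¬ (j:ℕ) = M + (k+1) := by omega
            have h5 : ¬ (j:ℕ) + (M+1) = k := by omega
            have h6 : ¬ (j:ℕ) + (M+1) = M + (k+1) := by omega
            simp [h4, this, h5, h6]
        · intro b _ hb
          have hb' : (b:ℕ) ≠ 0 := fun h => hb (Fin.ext h)
          rw [hX1, if_neg (by omega), if_neg (by omega), zero_mul]
        · simp
      · have hlt : (i:ℕ) + 1 < M + 1 := by omega
        rw [Finset.sum_eq_single ⟨i+1, hlt⟩]
        · rw [ih (by omega), hX1, if_pos rfl, one_mul]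
          have h1 : (i:ℕ) + 1 + k = i + (k+1) := by omega
          simp only [h1]
        · intro b _ hb
          have hb' : (b:ℕ) ≠ i + 1 := fun h => hb (Fin.ext h)
          rw [hX1, if_neg (by omega), if_neg (by omega), zero_mul]
        · simp
  have hpN : X1 ^ (M+1) = d • (1 : Matrix (Fin (M+1)) (Fin (M+1)) ℤ) := by
    ext i j
    rw [hpow _ le_rfl, if_neg (by omega), Matrix.smul_apply, Matrix.one_apply]
    by_cases h : i = j
    · simp [h]
    · have h1 : ¬ (j:ℕ) = i := fun h' => h (Fin.ext h'.symm)
      simp [h, h1]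
  have htr' : S (Sum.inl ()) (Sum.inl ()) + S.toBlocks₂₂.trace = 0 := by
    rw [← htr]; simp [Matrix.trace, Matrix.toBlocks₂₂]
  have hu : ∀ k : Fin (M+1), ∃ u : ℤ, d * u + (X1 ^ ((k:ℕ)+1) * S.toBlocks₂₂).trace = 0 ∧
      (k = Fin.last M → u = S (Sum.inl ()) (Sum.inl ())) := by
    intro k
    by_cases hk : k = Fin.last M
    · refine ⟨S (Sum.inl ()) (Sum.inl ()), ?_, fun _ => rfl⟩
      rw [hk, Fin.val_last, hpN, Matrix.smul_mul, Matrix.one_mul, Matrix.trace_smul, smul_eq_mul,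
        ← mul_add, htr', mul_zero]
    · have hk' : (k:ℕ) ≠ M := fun h => hk (Fin.ext h)
      have : d ∣ (X1 ^ ((k:ℕ)+1) * S.toBlocks₂₂).trace := by
        rw [Matrix.trace]
        apply Finset.dvd_sum
        intro i _
        rw [Matrix.diag_apply, Matrix.mul_apply]
        apply Finset.dvd_sum
        intro j _
        by_cases hij : j = i
        · subst hij
          rw [hpow _ (by omega), if_neg (by omega), if_neg (by omega), zero_mul]
          exact dvd_zero _
        · exact (hd j i hij).mul_left _
      obtain ⟨v, hv⟩ := this
      exact ⟨-v, by rw [hv]; ring, fun h => (hk h).elim⟩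
  choose u hu1 hu2 using hu
  set r := S (Sum.inl ()) (Sum.inl ()) with hr
  have hur : u (Fin.last M) = r := hu2 _ rfl
  let U : Matrix (Fin (M+1)) Unit ℤ := Matrix.of fun i _ => u i
  have hU : ∀ k : Fin (M+1), (X1 ^ (k:ℕ) * U) 0 () = u k := by
    intro k
    rw [Matrix.mul_apply, Finset.sum_eq_single k]
    · rw [hpow _ (by omega)]; simp [U]
    · intro b _ hb
      have hb' : (b:ℕ) ≠ k := fun h => hb (Fin.ext h)
      have h2 : ¬ ((b:ℕ) + (M+1) = k) := by omega
      rw [hpow _ (by omega)]; simp [hb', h2]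
    · simp
  let X : Matrix (Unit ⊕ Fin (M+1)) (Unit ⊕ Fin (M+1)) ℤ := Matrix.fromBlocks 0 0 U X1
  have hXp : ∀ k : ℕ, X ^ (k+1) = Matrix.fromBlocks 0 0 (X1 ^ k * U) (X1 ^ (k+1)) := by
    intro k
    induction k with
    | zero => simp [X]
    | succ k ih =>
      rw [pow_succ', ih, Matrix.fromBlocks_multiply]
      simp [← Matrix.mul_assoc, ← pow_succ']
  have hXN : X ^ (M+1+1) = d • X := by
    rw [hXp, hpN, pow_succ, hpN, Matrix.fromBlocks_smul]
    simp only [Matrix.smul_mul, Matrix.one_mul, smul_zero]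
  have htk : ∀ k : ℕ, (X ^ k * S).trace = 0 := by
    intro k
    induction k using Nat.strong_induction_on with
    | _ k ih =>
    rcases k with _ | k
    · simpa using htr
    by_cases hk : k < M + 1
    · rw [hXp, ← Matrix.fromBlocks_toBlocks S, Matrix.fromBlocks_multiply]
      have tfb : ∀ (A : Matrix Unit Unit ℤ) B C (D : Matrix (Fin (M+1)) (Fin (M+1)) ℤ),
          (Matrix.fromBlocks A B C D).trace = A.trace + D.trace := by
        intro A B C D; simp [Matrix.trace]
      rw [tfb]
      have h1 := hu1 ⟨k, hk⟩
      have h2 := hU ⟨k, hk⟩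
      simp only at h1 h2
      have h3 : (X1 ^ k * U * S.toBlocks₁₂).trace = d * u ⟨k, hk⟩ := by
        rw [Matrix.trace_mul_comm, Matrix.trace]
        simp only [Finset.univ_unique, Finset.sum_singleton, Matrix.diag_apply]
        rw [Matrix.mul_apply, Finset.sum_eq_single 0]
        · change S (Sum.inl ()) (Sum.inr 0) * (X1 ^ k * U) 0 () = _
          rw [h2, h01]; simp
        · intro b _ hb
          change S (Sum.inl ()) (Sum.inr b) * _ = _
          rw [h01]; simp [hb]
        · simp
      rw [Matrix.trace_add (X1 ^ k * U * S.toBlocks₁₂), h3, h1]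
      simp
    · obtain ⟨j, rfl⟩ := Nat.exists_eq_add_of_le (not_lt.mp hk)
      have : X ^ (M + 1 + j + 1) = d • X ^ (j+1) := by
        rw [show M + 1 + j + 1 = (M+1+1) + j by ring, pow_add, hXN, Matrix.smul_mul, ← pow_succ']
      rw [this, Matrix.smul_mul, Matrix.trace_smul, ih (j+1) (by omega), smul_zero]
  have main : ∀ α : ℤ, ∃ Y, X * Y - Y * X = ((r - α * d) * (r - α * d)) • S := by
    intro α
    let w : Unit ⊕ Fin (M+1) → ℤ := Sum.elim (fun _ => α) (Pi.single 0 1)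
    have hw : ∀ k : Fin (M+1), w ᵥ* X ^ ((k:ℕ)+1) =
        Sum.elim (fun _ => u k) (fun j => (X1 ^ ((k:ℕ)+1)) 0 j) := by
      intro k
      rw [hXp]
      simp only [w, Matrix.vecMul_fromBlocks]
      funext b
      rcases b with b | b
      · simp [Matrix.row, ← hU k]
      · simp [Matrix.row]
    have hwl : w ᵥ* X ^ (M+1) = Sum.elim (fun _ => r) (d • Pi.single 0 1) := by
      have := hw (Fin.last M)
      rw [Fin.val_last, hur, hpN] at this
      rw [this]
      congr 1
      funext j
      by_cases hj : 0 = j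
      · subst hj; simp
      · simp [Matrix.one_apply, hj, Ne.symm hj, -zsmul_eq_mul, -zsmul_one]
    have hwm : ∀ k : Fin M, w ᵥ* X ^ ((k:ℕ)+1) =
        Sum.elim (fun _ => u k.castSucc) (Pi.single k.succ 1) := by
      intro k
      have := hw k.castSucc
      rw [Fin.val_castSucc] at this
      rw [this]
      congr 1
      funext j
      rw [hpow _ (by omega)]
      by_cases hj : j = k.succ
      · subst hj; simp
      · have h1 : ¬ (j:ℕ) = k + 1 := fun h => hj (Fin.ext h)
        have h2 : ¬ (j:ℕ) + (M+1) = k + 1 := by omega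
        simp [hj, h1, h2]
    let Wl : Fin (M+1+1) → ℤ := Pi.single (Fin.last (M+1)) 1 - Pi.single 0 d
    let W' : Matrix (Unit ⊕ Fin (M+1)) (Fin (M+1+1)) ℤ := Matrix.of <| Sum.elim
      (fun _ => Wl)
      (Fin.cons (Pi.single 0 r - Pi.single (Fin.last (M+1)) α)
        (fun l : Fin M => Pi.single l.succ.castSucc (r - α * d) - u l.castSucc • Wl))
    refine cyclic_comm (M+1) (Fintype.equivOfCardEq (by simp; ring)) X S d (r - α * d) (by omega)
      hXN w W' ?_ htk
    set W : Matrix (Fin (M+1+1)) (Unit ⊕ Fin (M+1)) ℤ :=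
      Matrix.of fun k : Fin (M+1+1) => w ᵥ* X ^ (k:ℕ) with hWdef
    have g0 : W 0 = w := by
      change w ᵥ* X ^ 0 = w
      simp
    have gl : W (Fin.last (M+1)) = Sum.elim (fun _ => r) (d • Pi.single 0 1) := by
      rw [← hwl]; rfl
    have gm : ∀ k : Fin M, W k.succ.castSucc =
        Sum.elim (fun _ => u k.castSucc) (Pi.single k.succ 1) := by
      intro k; rw [← hwm]; rfl
    have hWl : Wl ᵥ* W = Sum.elim (fun _ => r - α * d) 0 := by
      simp only [Wl, Matrix.sub_vecMul, Matrix.single_vecMul, Matrix.row, gl, g0, w]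
      funext b
      rcases b with b | b
      · simp; ring
      · simp
    funext a
    change W' a ᵥ* W = _
    rcases a with a | a
    · change Wl ᵥ* W = _
      rw [hWl]
      funext b
      rcases b with b | b
      · simp [Matrix.smul_apply, -zsmul_eq_mul, -zsmul_one]
      · simp [Matrix.smul_apply, -zsmul_eq_mul, -zsmul_one]
    · induction a using Fin.cases with
      | zero =>
        change (Pi.single 0 r - Pi.single (Fin.last (M+1)) α) ᵥ* W = _
        simp only [Matrix.sub_vecMul, Matrix.single_vecMul, Matrix.row, gl, g0, w]
        funext b
        rcases b with b | b
        · simp [Matrix.smul_apply, -zsmul_eq_mul, -zsmul_one]; ring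
        · by_cases hb : 0 = b
          · subst hb
            simp [Matrix.smul_apply, -zsmul_eq_mul, -zsmul_one]
          · simp [Matrix.smul_apply, Matrix.one_apply, hb, Ne.symm hb, -zsmul_eq_mul, -zsmul_one]
      | succ l =>
        change (Pi.single l.succ.castSucc (r - α * d) - u l.castSucc • Wl) ᵥ* W = _
        rw [Matrix.sub_vecMul, Matrix.smul_vecMul, hWl, Matrix.single_vecMul, Matrix.row, gm]
        funext b
        rcases b with b | b
        · simp [Matrix.smul_apply, -zsmul_eq_mul, -zsmul_one]; ring
        · by_cases hb : l.succ = b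
          · subst hb
            simp [Matrix.smul_apply, -zsmul_eq_mul, -zsmul_one]
          · simp [Matrix.smul_apply, Matrix.one_apply, hb, Ne.symm hb, -zsmul_eq_mul, -zsmul_one]
  obtain ⟨Y0, hY0⟩ := main 0
  obtain ⟨Y1, hY1⟩ := main 1
  have hc : IsCoprime (r * r) ((r - 1 * d) * (r - 1 * d)) := by
    have : IsCoprime r (r - 1 * d) := by
      have := (hco.neg_right).add_mul_left_right 1
      rwa [show -d + r * 1 = r - 1 * d by ring] at this
    exact (this.mul_left this).mul_right (this.mul_left this)
  obtain ⟨a, b, hab⟩ := hc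
  refine ⟨X, a • Y0 + b • Y1, ?_⟩
  have : X * (a • Y0 + b • Y1) - (a • Y0 + b • Y1) * X =
      a • (X * Y0 - Y0 * X) + b • (X * Y1 - Y1 * X) := by
    simp only [Matrix.mul_add, Matrix.add_mul, Matrix.mul_smul, Matrix.smul_mul, smul_sub]
    abel
  rw [this, hY0, hY1, smul_smul, smul_smul, ← add_smul]
  have : a * ((r - 0 * d) * (r - 0 * d)) + b * ((r - 1 * d) * (r - 1 * d)) = 1 := by
    linear_combination hab
  rw [this, one_smul]

lemma content {ι : Type*} [Fintype ι] [DecidableEq ι] (M : Matrix ι ι ℤ) (hM : M ≠ 0) :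
    ∃ (g : ℤ) (M' : Matrix ι ι ℤ), M = g • M' ∧ ∀ p : ℤ, Prime p → ¬ ∀ a b, p ∣ M' a b := by
  have hne : (Finset.univ : Finset (ι × ι)).Nonempty := by
    by_contra h
    apply hM
    ext a b
    exact (h ⟨(a, b), Finset.mem_univ _⟩).elim
  obtain ⟨f, hf, hg⟩ := Finset.extract_gcd (fun x : ι × ι => M x.1 x.2) hne
  refine ⟨Finset.univ.gcd (fun x : ι × ι => M x.1 x.2), Matrix.of fun a b => f (a, b), ?_, ?_⟩
  · ext a b
    simpa [-zsmul_eq_mul] using hf (a, b) (Finset.mem_univ _)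
  · intro p hp h
    have : p ∣ Finset.univ.gcd f := Finset.dvd_gcd fun x _ => h x.1 x.2
    rw [hg] at this
    exact hp.not_unit (isUnit_of_dvd_one this)

lemma equiv_two (M : ℕ) (i j : Fin (M+2)) (hij : i ≠ j) :
    ∃ e : Unit ⊕ Fin (M+1) ≃ Fin (M+2), e (Sum.inl ()) = i ∧ e (Sum.inr 0) = j := by
  let e0 : Unit ⊕ Fin (M+1) ≃ Fin (M+2) := Fintype.equivOfCardEq (by simp; ring)
  let e1 := e0.trans (Equiv.swap (e0 (Sum.inl ())) i)
  have h1 : e1 (Sum.inl ()) = i := by simp [e1]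
  let e2 := e1.trans (Equiv.swap (e1 (Sum.inr 0)) j)
  refine ⟨e2, ?_, by simp [e2]⟩
  have : e1 (Sum.inr 0) ≠ i := by
    rw [← h1]; intro h; simpa using e1.injective h
  simp only [e2, Equiv.trans_apply, h1]
  exact Equiv.swap_apply_of_ne_of_ne this.symm hij

lemma reindex_comm {ι κ : Type*} [Fintype ι] [Fintype κ] (e : ι ≃ κ)
    (S : Matrix κ κ ℤ) (h : ∃ X Y, X * Y - Y * X = S.submatrix e e) :
    ∃ X Y, X * Y - Y * X = S := by
  obtain ⟨X, Y, h⟩ := h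
  refine ⟨X.submatrix e.symm e.symm, Y.submatrix e.symm e.symm, ?_⟩
  rw [Matrix.submatrix_mul_equiv, Matrix.submatrix_mul_equiv]
  have : S = (S.submatrix e e).submatrix e.symm e.symm := by ext; simp
  rw [this, ← h]; rfl

lemma trace_zero_comm_big (m : ℕ) (S : Matrix (Fin (m+3)) (Fin (m+3)) ℤ) (htr : S.trace = 0) :
    ∃ X Y, X * Y - Y * X = S := by
  by_cases hS : S = 0
  · exact ⟨0, 0, by simp [hS]⟩
  obtain ⟨g, S1, hS1, hp1⟩ := content S hS
  have hg : g ≠ 0 := by rintro rfl; simp at hS1; exact hS hS1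
  have htr1 : S1.trace = 0 := by
    rw [hS1, Matrix.trace_smul, smul_eq_mul] at htr
    exact (mul_eq_zero.mp htr).resolve_left hg
  suffices h : ∃ X Y, X * Y - Y * X = S1 by
    obtain ⟨X, Y, h⟩ := h
    refine ⟨X, g • Y, ?_⟩
    rw [hS1, ← h, Matrix.mul_smul, Matrix.smul_mul, smul_sub]
  obtain ⟨c, hc⟩ : ∃ c, c = S1 0 0 := ⟨_, rfl⟩
  have hR : S1 - c • (1 : Matrix (Fin (m+3)) (Fin (m+3)) ℤ) ≠ 0 := by
    intro h
    have h1 := sub_eq_zero.mp h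
    rw [h1, Matrix.trace_smul, Matrix.trace_one, smul_eq_mul] at htr1
    have h2 : c = 0 := by
      refine (mul_eq_zero.mp htr1).resolve_right ?_
      simp; omega
    rw [h2, zero_smul] at h1
    apply hS
    rw [hS1, h1, smul_zero]
  obtain ⟨d, R, hdR, hpR⟩ := content _ hR
  have hd : d ≠ 0 := by rintro rfl; rw [zero_smul] at hdR; exact hR hdR
  have hR0 : R 0 0 = 0 := by
    have := congrFun (congrFun hdR 0) 0
    simp only [Matrix.sub_apply, Matrix.smul_apply, Matrix.one_apply_eq, smul_eq_mul, mul_one,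
      hc, sub_self] at this
    exact (mul_eq_zero.mp this.symm).resolve_left hd
  have hS1R : S1 = c • (1 : Matrix (Fin (m+3)) (Fin (m+3)) ℤ) + d • R := by
    rw [← hdR]; abel
  have hcd : IsCoprime c d := by
    refine isCoprime_of_prime_dvd (fun h => hd h.2) ?_
    intro p hp hpc hpd
    apply hp1 p hp
    intro a b
    rw [hS1R]
    simp only [Matrix.add_apply, Matrix.smul_apply, smul_eq_mul]
    exact dvd_add (hpc.mul_right _) (hpd.mul_right _)
  obtain ⟨T, hT, i, j, hij, hu⟩ := exists_unit_entry R (by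
    intro i j
    obtain ⟨k, hk⟩ := Finset.exists_mem_notMem_of_card_lt_card
      (s := {i, j}) (t := (Finset.univ : Finset (Fin (m+3)))) (by
        have := Finset.card_le_two (a := i) (b := j)
        simp; omega)
    simp at hk
    exact ⟨k, Ne.symm hk.1, Ne.symm hk.2⟩) (by
    intro p hp hs
    apply hpR p hp
    intro a b
    by_cases hab : a = b
    · subst hab
      have := hs.2 a 0
      rwa [hR0, sub_zero] at this
    · exact hs.1 a b hab)
  have hsq : T i j * T i j = 1 := Int.isUnit_mul_self hu
  obtain ⟨T2, hT2, a2⟩ := Cj.row T j (fun b => if b = i ∨ b = j then 0 else T i j * T i b) (by simp)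
  have k1 : T2 i j = T i j := by rw [a2]; simp [hij]
  have k2 : ∀ b, b ≠ i → b ≠ j → T2 i b = 0 := by
    intro b h1 h2
    rw [a2]; simp [hij, h1, h2]
    linear_combination (-T i b) * hsq
  have hcj : Cj S1 (c • (1 : Matrix (Fin (m+3)) (Fin (m+3)) ℤ) + d • T2) := by
    obtain ⟨U, V, h1, h2, h3⟩ := hT.trans hT2
    refine ⟨U, V, h1, h2, ?_⟩
    rw [hS1R, h3]
    simp only [Matrix.mul_add, Matrix.add_mul, Matrix.mul_smul, Matrix.smul_mul, Matrix.mul_one, h1]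
  refine hcj.comm ?_
  set Q := c • (1 : Matrix (Fin (m+3)) (Fin (m+3)) ℤ) + d • T2 with hQ
  have hQa : ∀ a b, Q a b = c * (1 : Matrix (Fin (m+3)) (Fin (m+3)) ℤ) a b + d * T2 a b := by
    intro a b
    simp only [hQ, Matrix.add_apply, Matrix.smul_apply, smul_eq_mul]
  have hQtr : Q.trace = 0 := by
    obtain ⟨U, V, h1, h2, h3⟩ := hcj
    rw [h3, Matrix.trace_mul_comm, ← Matrix.mul_assoc, h2, Matrix.one_mul, htr1]
  obtain ⟨e, he1, he2⟩ := equiv_two (m+1) i j hij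
  apply reindex_comm e
  apply normal_comm (m+1) (Q.submatrix e e) (d * T i j)
  · intro b
    rw [Matrix.submatrix_apply, he1, hQa]
    have hb1 : e (Sum.inr b) ≠ i := by
      rw [← he1]; intro h; simpa using e.injective h
    by_cases hb : b = 0
    · subst hb
      rw [he2, k1]; simp [Matrix.one_apply, hij]
    · have hb2 : e (Sum.inr b) ≠ j := by
        rw [← he2]; intro h; exact hb (by simpa using e.injective h)
      rw [k2 _ hb1 hb2]; simp [Matrix.one_apply, hb1.symm, hb]
  · intro a b hab
    have hab' : e (Sum.inr a) ≠ e (Sum.inr b) := by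
      intro h; exact hab (by simpa using e.injective h)
    rw [Matrix.submatrix_apply, hQa, Matrix.one_apply_ne hab', mul_zero, zero_add]
    exact (hu.mul_right_dvd).mpr (dvd_mul_right _ _)
  · rw [Matrix.submatrix_apply, he1, hQa, Matrix.one_apply_eq, mul_one]
    refine IsCoprime.mul_right ?_ ⟨0, T i j, by simpa using hsq⟩
    exact hcd.add_mul_left_left _
  · rw [← hQtr, Matrix.trace, Matrix.trace]
    exact Equiv.sum_comp e (fun x => Q x x)

lemma trace_zero_comm (n : ℕ) (S : Matrix (Fin n) (Fin n) ℤ) (htr : S.trace = 0) :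
    ∃ X Y, X * Y - Y * X = S := by
  match n, S, htr with
  | 0, S, _ => exact ⟨0, 0, Subsingleton.elim _ _⟩
  | 1, S, htr =>
    refine ⟨0, 0, ?_⟩
    ext i j
    fin_cases i; fin_cases j
    simpa [Matrix.trace] using htr.symm
  | 2, S, htr => exact comm_two S htr
  | m+3, S, htr => exact trace_zero_comm_big m S htr

theorem stmt13 (n : ℕ) (P₀ S₀ : Matrix (Fin n) (Fin n) ℤ) (htr : P₀.trace = S₀.trace)
    (a₃ a₄ a₅ a₆ t₃ t₄ t₅ t₆ : ℤ) (h34 : a₃ * t₃ + a₄ * t₄ = 1) (h56 : a₅ * t₅ + a₆ * t₆ = 1) :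
    ∃ A₃ A₄ A₅ A₆ : Matrix (Fin n ⊕ Fin n) (Fin n ⊕ Fin n) ℤ,
      Matrix.fromBlocks P₀ 0 0 S₀ =
        a₃ • A₃ ^ 2 + a₄ • A₄ ^ 2 + a₅ • A₅ ^ 2 + a₆ • A₆ ^ 2 := by
  obtain ⟨X, Y, h⟩ := trace_zero_comm n (P₀ - S₀) (by rw [Matrix.trace_sub, htr, sub_self])
  have sq : ∀ (t : ℤ) (A B : Matrix (Fin n) (Fin n) ℤ), (Matrix.fromBlocks 0 (t • A) B 0) ^ 2 =
      t • Matrix.fromBlocks (A * B) 0 0 (B * A) := by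
    intro t A B
    rw [pow_two, Matrix.fromBlocks_multiply, Matrix.fromBlocks_smul]
    simp only [Matrix.smul_mul, Matrix.mul_smul, Matrix.mul_zero, Matrix.zero_mul, zero_add,
      add_zero, smul_zero]
  refine ⟨Matrix.fromBlocks 0 (t₃ • X) Y 0, Matrix.fromBlocks 0 (t₄ • X) Y 0,
    Matrix.fromBlocks 0 (t₅ • (P₀ - X * Y)) 1 0, Matrix.fromBlocks 0 (t₆ • (P₀ - X * Y)) 1 0, ?_⟩
  rw [sq, sq, sq, sq, smul_smul, smul_smul, smul_smul, smul_smul, ← add_smul, h34, add_assoc,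
    ← add_smul, h56, one_smul, one_smul, Matrix.fromBlocks_add]
  have hS : Y * X + 1 * (P₀ - X * Y) = S₀ := by
    have : S₀ = P₀ - (X * Y - Y * X) := by rw [h]; abel
    rw [Matrix.one_mul, this]; abel
  rw [hS]
  simp
end

section
/- For n ≥ 2, every n×n integer matrix is a sum of three squares of n×n integer matrices (Vaserstein). Equivalently, the form X² + Y² + Z² is universal over Mₙ(ℤ) for all n ≥ 2. -/
open Matrix

def shK (m : ℕ) (κ : ℤ) : Matrix (Fin (m+1)) (Fin (m+1)) ℤ :=
  Matrix.of fun i j => if i.val + 1 = j.val then 1 else if i.val = m ∧ j.val = m then κ else 0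

def Lf (w : ℕ → ℕ → ℤ) : ℕ → ℕ → ℤ
  | i, 0 => w (i-1) 0
  | i, (j+1) => w (i-1) (j+1) - Lf w (i-1) j

def Uf (M : ℕ → ℕ → ℤ) (π : ℕ → ℤ) (m : ℕ) : ℕ → ℕ → ℤ
  | 0, i => π i
  | (t+1), i => M i (m-t) - Uf M π m t (i+1)

lemma mul_shK (m : ℕ) (κ : ℤ) (f : ℕ → ℕ → ℤ) (i j : Fin (m+1)) :
    ((Matrix.of fun a b : Fin (m+1) => f a b) * shK m κ) i j =
      (if j.val = 0 then 0 else f i (j.val - 1)) + (if j.val = m then κ * f i m else 0) := by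
  have e : ∀ l : Fin (m+1), f i l * (if l.val + 1 = j.val then (1:ℤ) else if l.val = m ∧ j.val = m then κ else 0)
      = (if l.val + 1 = j.val then f i (j.val - 1) else 0) + (if l = Fin.last m then (if j.val = m then κ * f i m else 0) else 0) := by
    intro l
    have := j.isLt
    by_cases h1 : l.val + 1 = j.val
    · have h2 : l ≠ Fin.last m := by
        intro h; rw [h] at h1; simp at h1; omega
      have h3 : j.val - 1 = l.val := by omega
      simp [h1, h2, h3]
    · by_cases h2 : l = Fin.last m
      · subst h2
        simp only [Fin.val_last] at h1
        simp [h1, mul_comm]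
      · have : l.val ≠ m := fun h => h2 (Fin.ext h)
        simp [h1, h2, this]
  simp only [Matrix.mul_apply, shK, Matrix.of_apply]
  rw [Finset.sum_congr rfl (fun l _ => e l), Finset.sum_add_distrib]
  congr 1
  · by_cases h0 : j.val = 0
    · simp [h0]
    · rw [if_neg h0, Finset.sum_eq_single (⟨j.val - 1, by omega⟩ : Fin (m+1))]
      · rw [if_pos]; simp; omega
      · intro b _ hb
        rw [if_neg]
        intro h; apply hb; ext; simp; omega
      · simp
  · simp

lemma shK_mul (m : ℕ) (κ : ℤ) (f : ℕ → ℕ → ℤ) (i j : Fin (m+1)) :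
    (shK m κ * (Matrix.of fun a b : Fin (m+1) => f a b)) i j =
      if i.val = m then κ * f m j else f (i.val+1) j := by
  simp only [Matrix.mul_apply, shK, Matrix.of_apply]
  have hi := i.isLt
  split_ifs with h
  · rw [Finset.sum_eq_single (Fin.last m)]
    · simp [h]
    · intro b _ hb
      have : b.val ≠ m := fun h => hb (Fin.ext h)
      have h2 : i.val + 1 ≠ b.val := by omega
      simp [this, h2]
    · simp
  · rw [Finset.sum_eq_single (⟨i.val + 1, by omega⟩ : Fin (m+1))]
    · simp
    · intro b _ hb
      have h2 : i.val + 1 ≠ b.val := fun h => hb (Fin.ext h.symm)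
      simp [h, h2]
    · simp

lemma shift_lemma (m : ℕ) (W : Matrix (Fin (m+1)) (Fin (m+1)) ℤ) :
    ∃ h : ℤ, ∀ W2 : Matrix (Fin (m+1)) (Fin (m+1)) ℤ,
      (∀ i j, i ≠ Fin.last m → j ≤ i → W2 i j = W i j) →
      ∀ (κ : ℤ) (π : Fin (m+1) → ℤ), ∃ P K : Matrix (Fin (m+1)) (Fin (m+1)) ℤ,
        (∀ i, P i (Fin.last m) = π i) ∧
        (∀ i j, i ≠ Fin.last m → (P * K + K * P + K * K) i j = W2 i j) ∧
        (P * K + K * P + K * K) (Fin.last m) (Fin.last m) =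
          h + 2 * κ * π (Fin.last m) + κ ^ 2 := by
  let w : ℕ → ℕ → ℤ := fun i j => W (Fin.ofNat (m+1) i) (Fin.ofNat (m+1) j)
  refine ⟨if m = 0 then 0 else Lf w m (m-1), ?_⟩
  intro W2 hW κ π
  let kf : ℕ → ℕ → ℤ := fun i j => if i + 1 = j then 1 else if i = m ∧ j = m then κ else 0
  let p : ℕ → ℤ := fun i => π (Fin.ofNat (m+1) i)
  let M : ℕ → ℕ → ℤ := fun i j => W2 (Fin.ofNat (m+1) i) (Fin.ofNat (m+1) j)
    - (if j = m then κ * p i else 0) - kf (i+1) j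
  let f : ℕ → ℕ → ℤ := fun i j => if j < i then Lf w i j else Uf M p m (m-j) i
  have hof : ∀ i : Fin (m+1), Fin.ofNat (m+1) i.val = i := by intro i; simp
  have hKK : shK m κ = Matrix.of fun a b : Fin (m+1) => kf a b := rfl
  have hfm : ∀ i : Fin (m+1), f i.val m = π i := by
    intro i
    have := i.isLt
    simp only [f]
    rw [if_neg (by omega)]
    simp [Uf, p]
  have hkk : ∀ i j, (shK m κ * shK m κ) i j = if i.val = m then κ * kf m j else kf (i.val+1) j := by
    intro i j
    have := shK_mul m κ kf i j
    rwa [← hKK] at this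
  refine ⟨Matrix.of fun a b : Fin (m+1) => f a b, shK m κ, ?_, ?_, ?_⟩
  · intro i; simpa using hfm i
  · intro i j hi
    have hi' : i.val ≠ m := fun h => hi (Fin.ext h)
    have := i.isLt
    have := j.isLt
    rw [Matrix.add_apply, Matrix.add_apply, mul_shK, shK_mul, hkk, if_neg hi', if_neg hi', hfm]
    by_cases hji : j.val ≤ i.val
    · have hk : kf (i.val+1) j = 0 := by
        simp only [kf]; rw [if_neg (by omega), if_neg (by omega)]
      rw [hk, if_neg (show j.val ≠ m by omega), hW i j hi hji]
      simp only [f]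
      rw [if_pos (show j.val < i.val + 1 by omega)]
      rcases hj : j.val with _ | j'
      · simp only [Lf, w]
        have : (Fin.ofNat (m+1) 0) = j := by
          have h0 := hof j
          simp only [hj] at h0
          exact h0
        simp only [Nat.add_sub_cancel, hof, this]; simp
      · rw [if_neg (by omega), Nat.add_sub_cancel, if_pos (by omega)]
        simp only [Lf, w, Nat.add_sub_cancel]
        rw [hof, ← hj, hof]; ring
    · have h1 : f i (j.val - 1) = M i j - f (i.val+1) j := by
        simp only [f]
        rw [if_neg (by omega), if_neg (by omega)]
        have : m - (j.val - 1) = (m - j.val) + 1 := by omega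
        rw [this, Uf]
        congr 2; omega
      rw [if_neg (by omega), h1]
      simp only [M, p, hof]
      ring
  · rw [Matrix.add_apply, Matrix.add_apply, mul_shK, shK_mul, hkk]
    have hl := hfm (Fin.last m)
    simp only [Fin.val_last] at hl ⊢
    rw [hl]
    have : kf m m = κ := by simp [kf]
    rw [this]
    have h2 : (if m = 0 then (0:ℤ) else f m (m-1)) = if m = 0 then 0 else Lf w m (m-1) := by
      split_ifs with h
      · rfl
      · simp only [f]; rw [if_pos (by omega)]
    rw [h2]; simp; ring

def Good {ι : Type*} [Fintype ι] [DecidableEq ι] (A : Matrix ι ι ℤ) : Prop :=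
  ∃ B C D : Matrix ι ι ℤ, A = B ^ 2 + C ^ 2 + D ^ 2

lemma good_block {k m : Type*} [Fintype k] [DecidableEq k] [Fintype m] [DecidableEq m]
    (a : Matrix k k ℤ) (b : Matrix k m ℤ) (c : Matrix m k ℤ) (d : Matrix m m ℤ)
    (X X' P V V' : Matrix k k ℤ) (Q : Matrix k m ℤ) (R : Matrix m k ℤ) (S : Matrix m m ℤ)
    (y y' : ℤ) (hV : (X + y • (1 : Matrix k k ℤ)) * V = 1)
    (hV' : V' * (X' + y' • (1 : Matrix k k ℤ)) = 1)
    (ha : a = X * X + X' * X' + P * P + Q * R)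
    (hd : d = y ^ 2 • (1 : Matrix m m ℤ) + y' ^ 2 • (1 : Matrix m m ℤ) + S * S + R * Q) :
    Good (Matrix.fromBlocks a b c d) := by
  have e1 : X * (V * (b - P * Q - Q * S)) + y • (V * (b - P * Q - Q * S)) = b - P * Q - Q * S := by
    have : X * (V * (b - P * Q - Q * S)) + y • (V * (b - P * Q - Q * S))
      = ((X + y • (1 : Matrix k k ℤ)) * V) * (b - P * Q - Q * S) := by
      simp only [Matrix.add_mul, Matrix.mul_assoc, Matrix.smul_mul, Matrix.one_mul]
    rw [this, hV, Matrix.one_mul]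
  have e2 : ((c - R * P - S * R) * V') * X' + y' • ((c - R * P - S * R) * V') = c - R * P - S * R := by
    have : ((c - R * P - S * R) * V') * X' + y' • ((c - R * P - S * R) * V')
      = (c - R * P - S * R) * (V' * (X' + y' • (1 : Matrix k k ℤ))) := by
      simp only [Matrix.mul_add, Matrix.mul_assoc, Matrix.mul_smul, Matrix.mul_one]
    rw [this, hV', Matrix.mul_one]
  refine ⟨fromBlocks X (V * (b - P * Q - Q * S)) 0 (y • (1 : Matrix m m ℤ)),
    fromBlocks X' 0 ((c - R * P - S * R) * V') (y' • (1 : Matrix m m ℤ)),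
    fromBlocks P Q R S, ?_⟩
  simp only [pow_two, fromBlocks_multiply, fromBlocks_add, Matrix.mul_zero, Matrix.zero_mul,
    add_zero, zero_add, Matrix.mul_smul, Matrix.mul_one, Matrix.smul_mul, Matrix.one_mul, e1, e2]
  congr 1
  · rw [ha]; abel
  · abel
  · abel
  · rw [hd]; simp only [smul_smul, pow_two]; abel

lemma good_reindex {ι κ : Type*} [Fintype ι] [DecidableEq ι] [Fintype κ] [DecidableEq κ]
    (e : ι ≃ κ) (H : ∀ A : Matrix κ κ ℤ, Good A) (A : Matrix ι ι ℤ) : Good A := by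
  obtain ⟨B, C, D, h⟩ := H (Matrix.reindexAlgEquiv ℤ ℤ e A)
  refine ⟨(Matrix.reindexAlgEquiv ℤ ℤ e).symm B, (Matrix.reindexAlgEquiv ℤ ℤ e).symm C,
    (Matrix.reindexAlgEquiv ℤ ℤ e).symm D, ?_⟩
  rw [← map_pow, ← map_pow, ← map_pow, ← map_add, ← map_add, ← h]
  simp

/-- golden matrix -/
def gold {ι : Type*} [Fintype ι] [DecidableEq ι] (a b : ι) : Matrix ι ι ℤ :=
  1 - single a a 1 + single a b 1 + single b a 1

lemma gold_inv {ι : Type*} [Fintype ι] [DecidableEq ι] (a b : ι) (h : a ≠ b) :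
    ∃ V, gold a b * V = 1 ∧ V * gold a b = 1 := by
  have h' := h.symm
  have : gold a b * (1 - single a a 1 - single a a 1 + single a b 1 + single b a 1 - single b b 1) = 1 := by
    simp [gold, Matrix.mul_add, Matrix.add_mul, Matrix.mul_sub, Matrix.sub_mul, h, h']
    abel
  exact ⟨_, this, mul_eq_one_comm.mp this⟩

lemma gold_sq {ι : Type*} [Fintype ι] [DecidableEq ι] (a b : ι) (h : a ≠ b) :
    gold a b * gold a b = 1 + single a b 1 + single b a 1 + single b b 1 := by
  have h' := h.symm
  simp [gold, Matrix.mul_add, Matrix.add_mul, Matrix.mul_sub, Matrix.sub_mul, h, h']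
  abel

/-- the choice between identity and golden -/
lemma gold_choice {ι : Type*} [Fintype ι] [DecidableEq ι] (a b : ι) (h : a ≠ b) (t : ℤ) :
    ∃ (ε z : ℤ) (X V : Matrix ι ι ℤ), t = ε + 2 * z ∧ X * V = 1 ∧ V * X = 1 ∧
      X * X = 1 + single a b ε + single b a ε + single b b ε := by
  rcases Int.even_or_odd' t with ⟨z, hz | hz⟩
  · exact ⟨0, z, 1, 1, by omega, by simp, by simp, by simp⟩
  · obtain ⟨V, h1, h2⟩ := gold_inv a b h
    exact ⟨1, z, gold a b, V, by omega, h1, h2, gold_sq a b h⟩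

lemma good_odd (m : ℕ) (A : Matrix ((Fin (m+1) ⊕ Unit) ⊕ Fin (m+1)) ((Fin (m+1) ⊕ Unit) ⊕ Fin (m+1)) ℤ) :
    Good A := by
  set L := Fin.last m
  rw [← Matrix.fromBlocks_toBlocks A]
  set a := A.toBlocks₁₁
  set d := A.toBlocks₂₂
  obtain ⟨ε, z, X, V, ht, hXV, hVX, hXX⟩ := gold_choice (Sum.inl L : Fin (m+1) ⊕ Unit) (Sum.inr ()) (by simp)
    (a (Sum.inl L) (Sum.inr ()) - 1)
  set X' : Matrix (Fin (m+1) ⊕ Unit) (Fin (m+1) ⊕ Unit) ℤ := 1 + single (Sum.inl L) (Sum.inr ()) z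
  have hX'V : (1 - single (Sum.inl L) (Sum.inr ()) z) * X' = 1 := by
    simp [X', Matrix.mul_add, Matrix.sub_mul]
  have hX'X' : X' * X' = 1 + single (Sum.inl L) (Sum.inr ()) (2 * z) := by
    simp [X', Matrix.mul_add, Matrix.add_mul, two_mul, add_assoc, Matrix.single_add]
  set a1 := a.toBlocks₁₁
  set W : Matrix (Fin (m+1)) (Fin (m+1)) ℤ := d - a1 + 2
  obtain ⟨h, H⟩ := shift_lemma m W
  set a4 : ℤ := a (Sum.inr ()) (Sum.inr ()) - ε - 2
  obtain ⟨u, κ, hu⟩ : ∃ u κ : ℤ, W L L + a4 - h = u ^ 2 + 2 * κ := by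
    rcases Int.even_or_odd' (W L L + a4 - h) with ⟨κ, hz | hz⟩
    · exact ⟨0, κ, by rw [hz]; ring⟩
    · exact ⟨1, κ, by rw [hz]; ring⟩
  -- modified last column
  set p4 : ℤ := u + κ
  set π : Fin (m+1) → ℤ := fun i => if i = L then 1 - p4 else a (Sum.inl i) (Sum.inr ())
  obtain ⟨P1, K, hP, hW, hc⟩ := H W (fun _ _ _ _ => rfl) κ π
  set T := P1 * K + K * P1 + K * K
  set p3 : Fin (m+1) → ℤ := fun j => T L j - W L j
  have hp3 : p3 L = a4 - p4 ^ 2 := by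
    have hc' : T L L = h + 2 * κ * (1 - p4) + κ ^ 2 := by
      have : π L = 1 - p4 := by simp [π]
      rw [← this]; exact hc
    simp only [p3, hc', p4]
    linear_combination -hu
  have hT : T = W + Matrix.of fun i j => if i = L then p3 j else 0 := by
    ext i j
    by_cases hi : i = L
    · subst hi; simp [p3]
    · simp [hi, hW i j hi]
  set P : Matrix (Fin (m+1) ⊕ Unit) (Fin (m+1) ⊕ Unit) ℤ :=
    fromBlocks P1 (Matrix.of fun i _ => if i = L then 1 else 0) (Matrix.of fun _ j => p3 j) (Matrix.of fun _ _ => p4)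
  have hPP : P * P = fromBlocks (P1 * P1 + (Matrix.of fun i j => if i = L then p3 j else 0))
      (Matrix.of fun i _ => π i + if i = L then p4 else 0)
      ((Matrix.of fun (_ : Unit) j => p3 j) * P1 +
        (Matrix.of fun (_ _ : Unit) => p4) * (Matrix.of fun (_ : Unit) j => p3 j))
      (Matrix.of fun _ _ => p3 L + p4 ^ 2) := by
    simp only [P, fromBlocks_multiply]
    congr 1
    · congr 1; ext i j; simp [Matrix.mul_apply]
    · ext i j; simp [Matrix.mul_apply, ← hP, L]
    · ext i j; simp [Matrix.mul_apply, pow_two]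
  set M := a - X * X - X' * X' - P * P
  have hMc : ∀ i, M i (Sum.inr ()) = 0 := by
    intro i
    simp only [M, hXX, hX'X', hPP]
    rcases i with i | i
    · by_cases hi : i = L
      · subst hi
        simp [π, p4]
        linarith
      · have hi' : L ≠ i := fun h => hi h.symm
        simp [π, hi, hi']
    · simp [hp3, a4]
      ring
  refine good_block a _ _ d X X' P V (1 - single (Sum.inl L) (Sum.inr ()) z)
    (Matrix.of fun i j => M i (Sum.inl j)) (Matrix.of fun i j => if j = Sum.inl i then 1 else 0)
    (P1 + K) 0 0 (by simpa using hXV) (by simpa using hX'V) ?_ ?_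
  · have : (Matrix.of fun i j => M i (Sum.inl j)) * (Matrix.of fun (i : Fin (m+1)) (j : Fin (m+1) ⊕ Unit) => if j = Sum.inl i then (1:ℤ) else 0) = M := by
      ext i j
      rcases j with j | j
      · simp [Matrix.mul_apply]
      · simp [Matrix.mul_apply, hMc]
    rw [this]; simp only [M]; abel
  · have : (Matrix.of fun (i : Fin (m+1)) (j : Fin (m+1) ⊕ Unit) => if j = Sum.inl i then (1:ℤ) else 0) * (Matrix.of fun i j => M i (Sum.inl j)) = a1 - 2 - P1 * P1 - (Matrix.of fun i j => if i = L then p3 j else 0) := by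
      ext i j
      have e2 : (2 : Matrix (Fin (m+1)) (Fin (m+1)) ℤ) = 1 + 1 := by norm_num
      simp only [Matrix.mul_apply, Matrix.of_apply, ite_mul, one_mul, zero_mul, Finset.sum_ite_eq', Finset.mem_univ, if_true]
      simp [M, hXX, hX'X', hPP, a1, toBlocks₁₁, e2, Matrix.one_apply]
      ring
    rw [this]
    have e3 : (P1 + K) * (P1 + K) = P1 * P1 + T := by
      simp only [T]; noncomm_ring
    rw [e3, hT]
    simp only [W]
    simp
    abel

lemma bez (c0 c1 : ℤ) : ∃ g0 g1 f0 f1 : ℤ, c0 * g0 + c1 * g1 = 0 ∧ f0 * g0 + f1 * g1 = 1 := by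
  by_cases h : Int.gcd c0 c1 = 0
  · rw [Int.gcd_eq_zero_iff] at h
    exact ⟨1, 0, 1, 0, by simp [h.1], by simp⟩
  · obtain ⟨x, hx⟩ := Int.gcd_dvd_left c0 c1
    obtain ⟨y, hy⟩ := Int.gcd_dvd_right c0 c1
    have hb := Int.gcd_eq_gcd_ab c0 c1
    set g : ℤ := (Int.gcd c0 c1 : ℤ)
    have hg : g ≠ 0 := by simp only [g]; exact_mod_cast h
    refine ⟨y, -x, Int.gcdB c0 c1, -Int.gcdA c0 c1, ?_, ?_⟩
    · rw [hx, hy]; ring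
    · apply mul_left_cancel₀ hg
      linear_combination -hb - (Int.gcdB c0 c1) * hy - (Int.gcdA c0 c1) * hx

lemma nil_root (m : ℕ) (c : Fin (m+3) → ℤ) (hc : c (Fin.last (m+2)) = 0) :
    ∃ X V : Matrix (Fin (m+3)) (Fin (m+3)) ℤ, (X + 1) * V = 1 ∧
      X * X = vecMulVec (Pi.single (Fin.last (m+2)) 1) c := by
  obtain ⟨g0, g1, f0, f1, h1, h2⟩ := bez (c 0) (c 1)
  set L := Fin.last (m+2)
  have hL0 : (0 : Fin (m+3)) ≠ L := by simp [L, Fin.ext_iff]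
  have hL1 : (1 : Fin (m+3)) ≠ L := by simp [L, Fin.ext_iff]
  set f : Fin (m+3) → ℤ := Pi.single 0 f0 + Pi.single 1 f1
  set g : Fin (m+3) → ℤ := Pi.single 0 g0 + Pi.single 1 g1
  set e : Fin (m+3) → ℤ := Pi.single L 1
  have hfe : f ⬝ᵥ e = 0 := by simp [e, f, hL0, hL1, hL0.symm, hL1.symm]
  have hfg : f ⬝ᵥ g = 1 := by simp [f, g]; linarith
  have hce : c ⬝ᵥ e = 0 := by simp [e, hc]
  have hcg : c ⬝ᵥ g = 0 := by simp [g]; linarith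
  set X := vecMulVec e f + vecMulVec g c
  have hXX : X * X = vecMulVec e c := by
    simp [X, Matrix.mul_add, Matrix.add_mul, vecMulVec_mul_vecMulVec, hfe, hfg, hce, hcg]
  have hX3 : X * (X * X) = 0 := by
    rw [hXX]
    simp [X, Matrix.add_mul, vecMulVec_mul_vecMulVec, hfe, hce]
  refine ⟨X, 1 - X + X * X, ?_, hXX⟩
  have : (X + 1) * (1 - X + X * X) = 1 + X * (X * X) := by noncomm_ring
  rw [this, hX3, add_zero]

lemma good_even (m : ℕ) (A : Matrix (Fin (m+3) ⊕ Fin (m+3)) (Fin (m+3) ⊕ Fin (m+3)) ℤ) :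
    Good A := by
  rw [← Matrix.fromBlocks_toBlocks A]
  set a := A.toBlocks₁₁
  set d := A.toBlocks₂₂
  set L := Fin.last (m+2)
  have h0L : (0 : Fin (m+3)) ≠ L := by simp [L, Fin.ext_iff]
  set W := d - a
  obtain ⟨h, H⟩ := shift_lemma (m+2) W
  obtain ⟨ε, z, X', V', ht, hXV, hVX, hXX⟩ := gold_choice 0 L h0L (h + 1 - W L L)
  obtain ⟨P, K, -, hW, hc⟩ := H (W + single 0 L ε + single L 0 ε + single L L ε) (by
    intro i j hi hj
    have : ¬ (0 = i ∧ L = j) := by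
      rintro ⟨rfl, rfl⟩
      simp [L] at hj
    have hi' : L ≠ i := fun h => hi h.symm
    simp [Matrix.single_apply, this, hi']) 1 (fun _ => -z)
  set W2 := W + single 0 L ε + single L 0 ε + single L L ε
  set T := P * K + K * P + K * K
  obtain ⟨X, V, hV, hX⟩ := nil_root m (fun j => T L j - W2 L j) (by
    show T L L - W2 L L = 0
    rw [hc]
    simp [W2, h0L]
    linarith)
  have hT : T = W2 + X * X := by
    rw [hX]
    ext i j
    by_cases hi : i = L
    · subst hi; simp [vecMulVec_apply, L]
    · rw [hW i j hi]; simp [vecMulVec_apply, L, hi]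
  refine good_block a _ _ d X X' P V V' (a - X * X - X' * X' - P * P) 1 (P + K) 1 0
    (by simpa using hV) (by simpa using hVX) ?_ ?_
  · rw [Matrix.mul_one]; abel
  · have e3 : (P + K) * (P + K) = P * P + T := by
      simp only [T]; noncomm_ring
    rw [e3, hT, hXX]
    simp only [W2, W]
    simp
    abel

lemma good_four (A : Matrix (Fin 2 ⊕ Fin 2) (Fin 2 ⊕ Fin 2) ℤ) : Good A := by
  rw [← Matrix.fromBlocks_toBlocks A]
  set a := A.toBlocks₁₁
  set d := A.toBlocks₂₂
  obtain ⟨ε, z, X', V', ht, hXV, hVX, hXX⟩ := gold_choice (0 : Fin 2) 1 (by simp)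
    (1 - (d - a) 0 0 - (d - a) 1 1)
  -- W has odd trace 1 - 2 z
  set W := d - a + single 0 1 ε + single 1 0 ε + single 1 1 ε
  have hW : W = !![W 0 0, W 0 1; W 1 0, W 1 1] := Matrix.eta_fin_two W
  have htr : W 0 0 + W 1 1 = 1 - 2 * z := by
    simp [W] at ht ⊢
    linarith
  set S : Matrix (Fin 2) (Fin 2) ℤ := !![W 0 0 + z, W 0 1; W 1 0, W 1 1 + z]
  set p : ℤ := z - ((W 0 0 + z) * (W 1 1 + z) - W 0 1 * W 1 0)
  set P : Matrix (Fin 2) (Fin 2) ℤ := !![0, p; 1, 0]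
  have hSP : S * S = P * P + W := by
    rw [hW]
    have hw : W 1 1 = 1 - 2 * z - W 0 0 := by linarith
    ext i j
    fin_cases i <;> fin_cases j <;> simp [S, P, p, hw] <;> ring
  refine good_block a _ _ d 0 X' P 1 V' (a - X' * X' - P * P) 1 S 1 0
    (by simp) (by simpa using hVX) ?_ ?_
  · rw [Matrix.mul_one]; simp
  · rw [hSP, hXX]
    simp only [W]
    simp
    abel

lemma good_two (A : Matrix (Fin 2) (Fin 2) ℤ) : Good A := by
  obtain ⟨s, x, hx⟩ : ∃ s x : ℤ, A 1 1 - A 0 0 = s ^ 2 + 2 * x := by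
    rcases Int.even_or_odd' (A 1 1 - A 0 0) with ⟨κ, hz | hz⟩
    · exact ⟨0, κ, by rw [hz]; ring⟩
    · exact ⟨1, κ, by rw [hz]; ring⟩
  set x' := 1 - x
  set q := A 0 0 - x' ^ 2
  refine ⟨!![x', A 0 1 - q * s; 0, 1 - x'], !![0, 0; A 1 0 - s, 1], !![0, q; 1, s], ?_⟩
  have h11 : A 1 1 = A 0 0 + s ^ 2 + 2 * x := by linarith
  rw [Matrix.eta_fin_two A]
  ext i j
  fin_cases i <;> fin_cases j <;> simp [pow_two, q, x', h11] <;> ring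

theorem stmt17 (n : ℕ) (hn : 2 ≤ n) (A : Matrix (Fin n) (Fin n) ℤ) :
    ∃ B C D : Matrix (Fin n) (Fin n) ℤ, A = B ^ 2 + C ^ 2 + D ^ 2 := by
  change Good A
  rcases Nat.even_or_odd' n with ⟨k, rfl | rfl⟩
  · obtain rfl | rfl | ⟨m, rfl⟩ : k = 1 ∨ k = 2 ∨ ∃ m, k = m + 3 := by
      rcases k with _ | _ | _ | m
      · omega
      · simp
      · simp
      · right; right; exact ⟨m, rfl⟩
    · exact good_two A
    · exact good_reindex (Fintype.equivOfCardEq (by simp)) good_four A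
    · exact good_reindex (Fintype.equivOfCardEq (by simp; ring)) (good_even m) A
  · obtain ⟨m, rfl⟩ : ∃ m, k = m + 1 := ⟨k - 1, by omega⟩
    exact good_reindex (Fintype.equivOfCardEq (by simp; ring)) (good_odd m) A
end
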